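/- arXiv:1411.2078 — 9 statements merged into one kernel-verified Lean document; each statement's English description precedes it below -/
import Mathlib

section
/- For every τ in the complex upper half-plane, the Jacobi theta constants satisfy the quartic identity θ₃(τ)⁴ = θ₄(τ)⁴ + θ₂(τ)⁴. -/
noncomputable def theta2 (τ : ℂ) : ℂ :=
  ∑' n : ℤ, Complex.exp (Real.pi * Complex.I * ((n : ℂ) + 1/2)^2 * τ)

noncomputable def theta3 (τ : ℂ) : ℂ :=
  ∑' n : ℤ, Complex.exp (Real.pi * Complex.I * (n : ℂ)^2 * τ)

noncomputable def theta4 (τ : ℂ) : ℂ :=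
  ∑' n : ℤ, (-1 : ℂ)^n * Complex.exp (Real.pi * Complex.I * (n : ℂ)^2 * τ)

/-- The two sheets `(a + b, a - b)` and `(a + b, a - b - 1)` cover the integer lattice exactly once,
according to the parity of the sum of the coordinates. -/
theorem bijective_sum_elim_add_sub :
    Function.Bijective (Sum.elim (fun p : ℤ × ℤ => (p.1 + p.2, p.1 - p.2))
      (fun p : ℤ × ℤ => (p.1 + p.2, p.1 - p.2 - 1))) := by
  constructor
  · rintro (⟨a, b⟩ | ⟨a, b⟩) (⟨c, d⟩ | ⟨c, d⟩) h <;>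
      simp only [Sum.elim_inl, Sum.elim_inr, Prod.mk.injEq, Sum.inl.injEq, Sum.inr.injEq,
        reduceCtorEq] at h ⊢ <;> omega
  · rintro ⟨m, n⟩
    rcases Int.even_or_odd' (m + n) with ⟨k, hk | hk⟩
    · exact ⟨Sum.inl (k, m - k), by simp only [Sum.elim_inl, Prod.mk.injEq]; omega⟩
    · exact ⟨Sum.inr (k + 1, m - k - 1), by simp only [Sum.elim_inr, Prod.mk.injEq]; omega⟩

theorem tsum_eq_tsum_add_sub_add_tsum_add_sub_sub_one {F : ℤ × ℤ → ℂ} (hF : Summable F) :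
    ∑' p, F p = ∑' p : ℤ × ℤ, F (p.1 + p.2, p.1 - p.2)
      + ∑' p : ℤ × ℤ, F (p.1 + p.2, p.1 - p.2 - 1) := by
  let e := Equiv.ofBijective _ bijective_sum_elim_add_sub
  have hs : Summable (F ∘ e) := e.summable_iff.mpr hF
  rw [← e.tsum_eq F]
  exact Summable.tsum_sum (f := F ∘ e) (hs.comp_injective Sum.inl_injective)
    (hs.comp_injective Sum.inr_injective)

theorem summable_theta3 {τ : ℂ} (hτ : 0 < τ.im) :
    Summable fun n : ℤ => Complex.exp (Real.pi * Complex.I * (n : ℂ) ^ 2 * τ) := by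
  simpa [jacobiTheta₂_term] using (hasSum_jacobiTheta₂_term 0 hτ).summable

theorem summable_theta4 {τ : ℂ} (hτ : 0 < τ.im) :
    Summable fun n : ℤ =>
      (-1 : ℂ) ^ n * Complex.exp (Real.pi * Complex.I * (n : ℂ) ^ 2 * τ) := by
  refine .of_norm ?_
  simpa using (summable_theta3 hτ).norm

theorem summable_theta2 {τ : ℂ} (hτ : 0 < τ.im) :
    Summable fun n : ℤ => Complex.exp (Real.pi * Complex.I * ((n : ℂ) + 1 / 2) ^ 2 * τ) := by
  refine ((hasSum_jacobiTheta₂_term (τ / 2) hτ).summable.mul_left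
    (Complex.exp (Real.pi * Complex.I * τ / 4))).congr fun n => ?_
  rw [jacobiTheta₂_term, ← Complex.exp_add]
  ring_nf

theorem theta2_eq_tsum_sub_half (τ : ℂ) :
    theta2 τ = ∑' n : ℤ, Complex.exp (Real.pi * Complex.I * ((n : ℂ) - 1 / 2) ^ 2 * τ) := by
  rw [theta2, ← (Equiv.subRight (1 : ℤ)).tsum_eq]
  refine tsum_congr fun n => ?_
  simp only [Equiv.subRight_apply, Int.cast_sub, Int.cast_one]
  ring_nf

theorem summable_theta2_sub_half {τ : ℂ} (hτ : 0 < τ.im) :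
    Summable fun n : ℤ => Complex.exp (Real.pi * Complex.I * ((n : ℂ) - 1 / 2) ^ 2 * τ) := by
  refine ((Equiv.subRight (1 : ℤ)).summable_iff.mpr (summable_theta2 hτ)).congr fun n => ?_
  simp only [Function.comp_apply, Equiv.subRight_apply, Int.cast_sub, Int.cast_one]
  ring_nf

theorem tsum_sq_eq_of_add_sub {f u v u' v' : ℤ → ℂ} (hf : Summable f) (hu : Summable u)
    (hv : Summable v) (hu' : Summable u') (hv' : Summable v')
    (h : ∀ a b, f (a + b) * f (a - b) = u a * v b)
    (h' : ∀ a b, f (a + b) * f (a - b - 1) = u' a * v' b) :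
    (∑' n, f n) ^ 2 = (∑' n, u n) * (∑' n, v n) + (∑' n, u' n) * (∑' n, v' n) := by
  rw [sq, tsum_mul_tsum_of_summable_norm hf.norm hf.norm,
    tsum_mul_tsum_of_summable_norm hu.norm hv.norm,
    tsum_mul_tsum_of_summable_norm hu'.norm hv'.norm,
    tsum_eq_tsum_add_sub_add_tsum_add_sub_sub_one
      (summable_mul_of_summable_norm hf.norm hf.norm)]
  simp only [h, h']

theorem two_mul_im_pos {τ : ℂ} (hτ : 0 < τ.im) : 0 < (2 * τ).im := by
  simpa using hτ

theorem theta3_sq {τ : ℂ} (hτ : 0 < τ.im) :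
    theta3 τ ^ 2 = theta3 (2 * τ) ^ 2 + theta2 (2 * τ) ^ 2 := by
  have h := two_mul_im_pos hτ
  rw [sq (theta3 (2 * τ)), sq (theta2 (2 * τ))]
  nth_rw 1 [theta2_eq_tsum_sub_half]
  refine tsum_sq_eq_of_add_sub (summable_theta3 hτ) (summable_theta3 h) (summable_theta3 h)
    (summable_theta2_sub_half h) (summable_theta2 h) (fun a b => ?_) fun a b => ?_ <;>
  · simp only [← Complex.exp_add]
    push_cast
    ring_nf

theorem theta4_sq {τ : ℂ} (hτ : 0 < τ.im) :
    theta4 τ ^ 2 = theta3 (2 * τ) ^ 2 - theta2 (2 * τ) ^ 2 := by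
  have h := two_mul_im_pos hτ
  rw [sub_eq_add_neg, sq (theta3 (2 * τ)), sq (theta2 (2 * τ)), ← neg_mul]
  nth_rw 1 [theta2_eq_tsum_sub_half]
  rw [← tsum_neg]
  refine tsum_sq_eq_of_add_sub (summable_theta4 hτ) (summable_theta3 h) (summable_theta3 h)
    (summable_theta2_sub_half h).neg (summable_theta2 h) (fun a b => ?_) fun a b => ?_
  · have hs : (-1 : ℂ) ^ (a + b) * (-1) ^ (a - b) = 1 := by
      rw [← zpow_add₀ (by norm_num)]
      exact Even.neg_one_zpow ⟨a, by ring⟩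
    rw [mul_mul_mul_comm, hs, one_mul]
    simp only [← Complex.exp_add]
    push_cast
    ring_nf
  · have hs : (-1 : ℂ) ^ (a + b) * (-1) ^ (a - b - 1) = -1 := by
      rw [← zpow_add₀ (by norm_num)]
      exact Odd.neg_one_zpow ⟨a - 1, by ring⟩
    rw [mul_mul_mul_comm, hs, neg_one_mul, neg_mul]
    simp only [← Complex.exp_add]
    push_cast
    ring_nf

theorem theta2_sq {τ : ℂ} (hτ : 0 < τ.im) :
    theta2 τ ^ 2 = 2 * theta2 (2 * τ) * theta3 (2 * τ) := by
  have h := two_mul_im_pos hτ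
  have key : theta2 τ ^ 2 =
      theta2 (2 * τ) * theta3 (2 * τ) + theta3 (2 * τ) * theta2 (2 * τ) := by
    refine tsum_sq_eq_of_add_sub (summable_theta2 hτ) (summable_theta2 h) (summable_theta3 h)
      (summable_theta3 h) (summable_theta2 h) (fun a b => ?_) fun a b => ?_ <;>
    · simp only [← Complex.exp_add]
      push_cast
      ring_nf
  rw [key]
  ring

theorem theta_quartic_identity (τ : ℂ) (hτ : 0 < τ.im) :
    theta3 τ ^ 4 = theta4 τ ^ 4 + theta2 τ ^ 4 := by
  have h (x : ℂ) : x ^ 4 = (x ^ 2) ^ 2 := by ring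
  rw [h, h (theta4 τ), h (theta2 τ), theta3_sq hτ, theta4_sq hτ, theta2_sq hτ]
  ring
end

section
/- For every τ in the complex upper half-plane, the quadratic (2-isogeny) identities θ₃(2τ)² = (1/2)(θ₃(τ)² + θ₄(τ)²) and θ₄(2τ)² = θ₃(τ)·θ₄(τ) hold. -/
theorem summable_norm_theta_term {τ : ℂ} (hτ : 0 < τ.im) :
    Summable fun n : ℤ => ‖Complex.exp (Real.pi * Complex.I * (n : ℂ) ^ 2 * τ)‖ := by
  refine (((summable_jacobiTheta₂_term_iff 0 τ).2 hτ).norm).congr fun n => ?_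
  simp [jacobiTheta₂_term]

theorem norm_neg_one_zpow_mul (n : ℤ) (z : ℂ) : ‖(-1 : ℂ) ^ n * z‖ = ‖z‖ := by
  simp [norm_zpow]

theorem injective_add_sub_int : Function.Injective fun p : ℤ × ℤ => (p.1 + p.2, p.1 - p.2) := by
  rintro ⟨a, b⟩ ⟨c, d⟩ h
  simp only [Prod.mk.injEq] at h ⊢
  omega

theorem mem_range_add_sub_int {p : ℤ × ℤ} (h : Even (p.1 + p.2)) :
    p ∈ Set.range fun p : ℤ × ℤ => (p.1 + p.2, p.1 - p.2) := by
  obtain ⟨k, hk⟩ := h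
  refine ⟨(k, p.1 - k), Prod.ext ?_ ?_⟩ <;> simp only <;> omega

/-- A double theta series supported on pairs of equal parity, reindexed by `(m + n, m - n)`. -/
theorem tsum_theta_term_add_sub (τ : ℂ) (w : ℤ × ℤ → ℂ)
    (hw : ∀ p : ℤ × ℤ, ¬ Even (p.1 + p.2) → w p = 0) :
    ∑' p : ℤ × ℤ, w p * (Complex.exp (Real.pi * Complex.I * (p.1 : ℂ) ^ 2 * τ) *
      Complex.exp (Real.pi * Complex.I * (p.2 : ℂ) ^ 2 * τ)) =
    ∑' p : ℤ × ℤ, w (p.1 + p.2, p.1 - p.2) *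
      (Complex.exp (Real.pi * Complex.I * (p.1 : ℂ) ^ 2 * (2 * τ)) *
      Complex.exp (Real.pi * Complex.I * (p.2 : ℂ) ^ 2 * (2 * τ))) := by
  rw [← injective_add_sub_int.tsum_eq]
  · refine tsum_congr fun p => ?_
    simp only [← Complex.exp_add]
    push_cast
    ring_nf
  · intro p hp
    refine mem_range_add_sub_int ?_
    by_contra h
    exact hp (by simp [hw p h])

theorem theta_two_isogeny_identities (τ : ℂ) (hτ : 0 < τ.im) :
    theta3 (2 * τ) ^ 2 = (1 / 2) * (theta3 τ ^ 2 + theta4 τ ^ 2) ∧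
    theta4 (2 * τ) ^ 2 = theta3 τ * theta4 τ := by
  have h3 : ∀ {σ : ℂ}, 0 < σ.im → _ := fun h => summable_norm_theta_term h
  have h4 : ∀ {σ : ℂ}, 0 < σ.im → Summable fun n : ℤ =>
      ‖(-1 : ℂ) ^ n * Complex.exp (Real.pi * Complex.I * (n : ℂ) ^ 2 * σ)‖ := fun h => by
    simpa only [norm_neg_one_zpow_mul] using h3 h
  have h2 : 0 < (2 * τ).im := by simpa using hτ
  have hne : (-1 : ℂ) ≠ 0 := by norm_num
  constructor
  · have key := tsum_theta_term_add_sub τ (fun p => 1 + (-1) ^ (p.1 + p.2)) fun p hp => by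
      simp [(Int.not_even_iff_odd.1 hp).neg_one_zpow]
    have hl : theta3 τ ^ 2 + theta4 τ ^ 2 = ∑' p : ℤ × ℤ, (1 + (-1 : ℂ) ^ (p.1 + p.2)) *
        (Complex.exp (Real.pi * Complex.I * (p.1 : ℂ) ^ 2 * τ) *
        Complex.exp (Real.pi * Complex.I * (p.2 : ℂ) ^ 2 * τ)) := by
      rw [sq, sq, theta3, theta4, tsum_mul_tsum_of_summable_norm (h3 hτ) (h3 hτ),
        tsum_mul_tsum_of_summable_norm (h4 hτ) (h4 hτ),
        ← (summable_mul_of_summable_norm (h3 hτ) (h3 hτ)).tsum_add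
          (summable_mul_of_summable_norm (h4 hτ) (h4 hτ))]
      refine tsum_congr fun p => ?_
      rw [zpow_add₀ hne]
      ring
    have hr : 2 * theta3 (2 * τ) ^ 2 = ∑' p : ℤ × ℤ,
        (1 + (-1 : ℂ) ^ ((p.1 + p.2) + (p.1 - p.2))) *
        (Complex.exp (Real.pi * Complex.I * (p.1 : ℂ) ^ 2 * (2 * τ)) *
        Complex.exp (Real.pi * Complex.I * (p.2 : ℂ) ^ 2 * (2 * τ))) := by
      rw [sq, theta3, tsum_mul_tsum_of_summable_norm (h3 h2) (h3 h2), ← tsum_mul_left]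
      refine tsum_congr fun p => ?_
      rw [Even.neg_one_zpow ⟨p.1, by ring⟩]
      norm_num
    rw [hl, key, ← hr]
    ring
  · have key := tsum_theta_term_add_sub τ (fun p => (-1) ^ p.1 + (-1) ^ p.2) fun p hp => by
      rcases Int.even_or_odd p.1 with h | h <;> rcases Int.even_or_odd p.2 with h' | h'
      · exact absurd (h.add h') hp
      · simp [h.neg_one_zpow, h'.neg_one_zpow]
      · simp [h.neg_one_zpow, h'.neg_one_zpow]
      · exact absurd (h.add_odd h') hp
    have hl : 2 * (theta3 τ * theta4 τ) = ∑' p : ℤ × ℤ, ((-1 : ℂ) ^ p.1 + (-1 : ℂ) ^ p.2) *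
        (Complex.exp (Real.pi * Complex.I * (p.1 : ℂ) ^ 2 * τ) *
        Complex.exp (Real.pi * Complex.I * (p.2 : ℂ) ^ 2 * τ)) := by
      rw [two_mul]
      nth_rewrite 1 [mul_comm]
      rw [theta3, theta4, tsum_mul_tsum_of_summable_norm (h3 hτ) (h4 hτ),
        tsum_mul_tsum_of_summable_norm (h4 hτ) (h3 hτ),
        ← (summable_mul_of_summable_norm (h4 hτ) (h3 hτ)).tsum_add
          (summable_mul_of_summable_norm (h3 hτ) (h4 hτ))]
      refine tsum_congr fun p => ?_
      ring
    have hr : 2 * theta4 (2 * τ) ^ 2 = ∑' p : ℤ × ℤ,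
        ((-1 : ℂ) ^ (p.1 + p.2) + (-1 : ℂ) ^ (p.1 - p.2)) *
        (Complex.exp (Real.pi * Complex.I * (p.1 : ℂ) ^ 2 * (2 * τ)) *
        Complex.exp (Real.pi * Complex.I * (p.2 : ℂ) ^ 2 * (2 * τ))) := by
      rw [sq, theta4, tsum_mul_tsum_of_summable_norm (h4 h2) (h4 h2), ← tsum_mul_left]
      refine tsum_congr fun p => ?_
      have hsub : (-1 : ℂ) ^ (p.1 - p.2) = (-1) ^ p.1 * (-1) ^ p.2 := by
        rw [sub_eq_add_neg, zpow_add₀ hne, zpow_neg, ← inv_zpow, inv_neg_one]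
      rw [hsub, zpow_add₀ hne]
      ring
    exact mul_left_cancel₀ two_ne_zero (hr.trans (key.symm.trans hl.symm))
end

section
/- For every τ in the complex upper half-plane, the Borwein cubic theta functions satisfy A₃(τ)³ = B₃(τ)³ + C₃(τ)³. -/
noncomputable def A3 (τ : ℂ) : ℂ :=
  ∑' p : ℤ × ℤ, Complex.exp (2 * Real.pi * Complex.I *
    ((p.1 : ℂ)^2 + (p.1 : ℂ) * (p.2 : ℂ) + (p.2 : ℂ)^2) * τ)

noncomputable def B3 (τ : ℂ) : ℂ :=
  ∑' p : ℤ × ℤ, Complex.exp (2 * Real.pi * Complex.I * ((p.1 : ℂ) - (p.2 : ℂ)) / 3) *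
    Complex.exp (2 * Real.pi * Complex.I *
      ((p.1 : ℂ)^2 + (p.1 : ℂ) * (p.2 : ℂ) + (p.2 : ℂ)^2) * τ)

noncomputable def C3 (τ : ℂ) : ℂ :=
  ∑' p : ℤ × ℤ, Complex.exp (2 * Real.pi * Complex.I *
    ((p.1 : ℂ)^2 + (p.1 : ℂ) * (p.2 : ℂ) + (p.2 : ℂ)^2 + (p.1 : ℂ) + (p.2 : ℂ) + 1/3) * τ)

namespace BorweinCubic

open Complex

/-- The sum of `m - n` over the three pairs `(m, n)` of a triple. -/
def diffSum (x : (ℤ × ℤ) × (ℤ × ℤ) × (ℤ × ℤ)) : ℤ :=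
  (x.1.1 - x.1.2) + (x.2.1.1 - x.2.1.2) + (x.2.2.1 - x.2.2.2)

/-- The part of `∑' x, u x` over the triples with `diffSum x` congruent to `r` modulo `3`. -/
noncomputable def classSum (u : (ℤ × ℤ) × (ℤ × ℤ) × (ℤ × ℤ) → ℂ) (r : ℤ) : ℂ :=
  ∑' x, if diffSum x % 3 = r then u x else 0

/-- The summand of `A3`. -/
noncomputable def termA (τ : ℂ) (p : ℤ × ℤ) : ℂ :=
  exp (2 * Real.pi * I * ((p.1 : ℂ)^2 + (p.1 : ℂ) * (p.2 : ℂ) + (p.2 : ℂ)^2) * τ)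

/-- The summand of `C3`. -/
noncomputable def termC (τ : ℂ) (p : ℤ × ℤ) : ℂ :=
  exp (2 * Real.pi * I *
    ((p.1 : ℂ)^2 + (p.1 : ℂ) * (p.2 : ℂ) + (p.2 : ℂ)^2 + (p.1 : ℂ) + (p.2 : ℂ) + 1/3) * τ)

/-- The product of the values of `f` at the entries of a triple. -/
def cubeTerm {ι : Type*} (f : ι → ℂ) (x : ι × ι × ι) : ℂ := f x.1 * (f x.2.1 * f x.2.2)

lemma summable_cubeTerm {ι : Type*} {f : ι → ℂ} (hf : Summable fun i => ‖f i‖) :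
    Summable (cubeTerm f) :=
  summable_mul_of_summable_norm (f := f) (g := fun y : ι × ι => f y.1 * f y.2) hf (hf.mul_norm hf)

lemma tsum_pow_three {ι : Type*} {f : ι → ℂ} (hf : Summable fun i => ‖f i‖) :
    (∑' i, f i) ^ 3 = ∑' x, cubeTerm f x := by
  rw [pow_succ', sq, tsum_mul_tsum_of_summable_norm hf hf,
    tsum_mul_tsum_of_summable_norm hf (hf.mul_norm hf)]
  rfl

lemma summable_exp_neg_mul_abs {c : ℝ} (hc : 0 < c) :
    Summable fun n : ℤ => Real.exp (-c * |(n : ℝ)|) := by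
  have h : Summable fun n : ℕ => Real.exp (-c * |((n : ℤ) : ℝ)|) := by
    refine (Real.summable_exp_nat_mul_iff.mpr (neg_lt_zero.mpr hc)).congr fun n => ?_
    simp [mul_comm]
  exact Summable.of_nat_of_neg h (by simpa using h)

lemma summable_norm_exp_of_abs_le {τ : ℂ} (hτ : 0 < τ.im) (g : ℤ × ℤ → ℝ) (K : ℝ)
    (hg : ∀ p : ℤ × ℤ, |(p.1 : ℝ)| + |(p.2 : ℝ)| ≤ 4 * g p + K) :
    Summable fun p => ‖exp (2 * Real.pi * I * (g p : ℂ) * τ)‖ := by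
  have hc : 0 < Real.pi * τ.im / 2 := by positivity
  have hs := (summable_exp_neg_mul_abs hc).mul_of_nonneg (summable_exp_neg_mul_abs hc)
    (fun _ => (Real.exp_pos _).le) (fun _ => (Real.exp_pos _).le)
  refine Summable.of_nonneg_of_le (fun _ => norm_nonneg _) (fun p => ?_)
    (hs.mul_left (Real.exp (Real.pi * τ.im / 2 * K)))
  rw [norm_exp, ← Real.exp_add, ← Real.exp_add, Real.exp_le_exp]
  have : (2 * Real.pi * I * (g p : ℂ) * τ).re = -(Real.pi * τ.im / 2 * (4 * g p)) := by
    simp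
    ring
  rw [this]
  nlinarith [mul_le_mul_of_nonneg_left (hg p) hc.le]

lemma abs_le_sq_int (n : ℤ) : |(n : ℝ)| ≤ (n : ℝ) ^ 2 := by
  rw [← sq_abs]
  exact_mod_cast Int.le_self_sq |n|

lemma summable_norm_termA {τ : ℂ} (hτ : 0 < τ.im) : Summable fun p => ‖termA τ p‖ := by
  refine (summable_norm_exp_of_abs_le hτ
    (fun p => (p.1 : ℝ)^2 + (p.1 : ℝ) * (p.2 : ℝ) + (p.2 : ℝ)^2) 0 fun p => ?_).congr fun p => ?_
  · nlinarith [abs_le_sq_int p.1, abs_le_sq_int p.2, sq_nonneg ((p.1 : ℝ) + p.2)]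
  · simp [termA]

lemma summable_norm_termC {τ : ℂ} (hτ : 0 < τ.im) : Summable fun p => ‖termC τ p‖ := by
  refine (summable_norm_exp_of_abs_le hτ
    (fun p => (p.1 : ℝ)^2 + (p.1 : ℝ) * (p.2 : ℝ) + (p.2 : ℝ)^2 + p.1 + p.2 + 1/3) 8
    fun p => ?_).congr fun p => ?_
  · rcases abs_cases (p.1 : ℝ) with ⟨h1, -⟩ | ⟨h1, -⟩ <;>
    rcases abs_cases (p.2 : ℝ) with ⟨h2, -⟩ | ⟨h2, -⟩ <;> rw [h1, h2] <;>
    nlinarith [sq_nonneg ((p.1 : ℝ) + p.2), sq_nonneg ((p.1 : ℝ) + 3 / 2),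
      sq_nonneg ((p.2 : ℝ) + 3 / 2), sq_nonneg ((p.1 : ℝ) + 5 / 4),
      sq_nonneg ((p.2 : ℝ) + 5 / 4), sq_nonneg ((p.1 : ℝ) + p.2 + 1)]
  · simp [termC]

lemma summable_ite {ι : Type*} {u : ι → ℂ} (hu : Summable u) (P : ι → Prop) [DecidablePred P] :
    Summable fun x => if P x then u x else 0 := by
  refine (hu.indicator {x | P x}).congr fun x => ?_
  simp [Set.indicator_apply]

lemma tsum_eq_classSum_combination {u : (ℤ × ℤ) × (ℤ × ℤ) × (ℤ × ℤ) → ℂ} (hu : Summable u)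
    (c : ℤ → ℂ) :
    ∑' x, c (diffSum x % 3) * u x =
      c 0 * classSum u 0 + c 1 * classSum u 1 + c 2 * classSum u 2 := by
  have h (r : ℤ) := (summable_ite hu fun x => diffSum x % 3 = r).mul_left (c r)
  simp only [classSum, ← tsum_mul_left]
  rw [← (h 0).tsum_add (h 1), ← ((h 0).add (h 1)).tsum_add (h 2)]
  refine tsum_congr fun x => ?_
  have : diffSum x % 3 = 0 ∨ diffSum x % 3 = 1 ∨ diffSum x % 3 = 2 := by omega
  rcases this with h | h | h <;> simp [h]

lemma classSum_eq_of_equiv {u : (ℤ × ℤ) × (ℤ × ℤ) × (ℤ × ℤ) → ℂ} {r s : ℤ}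
    (e : (ℤ × ℤ) × (ℤ × ℤ) × (ℤ × ℤ) ≃ (ℤ × ℤ) × (ℤ × ℤ) × (ℤ × ℤ))
    (he : ∀ x, diffSum (e x) % 3 = s ↔ diffSum x % 3 = r) (hu : ∀ x, u (e x) = u x) :
    classSum u r = classSum u s := by
  rw [classSum, classSum, ← e.tsum_eq fun x => if diffSum x % 3 = s then u x else 0]
  simp only [he, hu]

lemma classSum_eq_tsum_comp {κ : Type*} {u : (ℤ × ℤ) × (ℤ × ℤ) × (ℤ × ℤ) → ℂ} {r : ℤ}
    {φ : κ → (ℤ × ℤ) × (ℤ × ℤ) × (ℤ × ℤ)} (hφ : Function.Injective φ)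
    (hr : ∀ x, diffSum x % 3 = r ↔ x ∈ Set.range φ) :
    classSum u r = ∑' v, u (φ v) := by
  rw [classSum, ← hφ.tsum_eq]
  · exact tsum_congr fun v => if_pos ((hr _).2 ⟨v, rfl⟩)
  · intro x hx
    by_contra h
    exact hx (if_neg (mt (hr x).1 h))

/-- A parametrization of the triples with `diffSum x` congruent to `1` modulo `3`. -/
def paramA (v : (ℤ × ℤ) × (ℤ × ℤ) × (ℤ × ℤ)) : (ℤ × ℤ) × (ℤ × ℤ) × (ℤ × ℤ) :=
  ((3 * v.1.1 + 1 + v.1.2 - v.2.1.1 + v.2.1.2 - v.2.2.1 + v.2.2.2, v.1.2), v.2.1, v.2.2)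

/-- The image of `paramA` under the unitary matrix `(1 - ω²)⁻¹ (ω ^ (i * j))`, in coordinates on
the coset of the Eisenstein integers that indexes `C3`. -/
def paramC (v : (ℤ × ℤ) × (ℤ × ℤ) × (ℤ × ℤ)) : (ℤ × ℤ) × (ℤ × ℤ) × (ℤ × ℤ) :=
  ((v.1.1, v.1.1 + v.1.2 + v.2.1.2 + v.2.2.2),
    (v.1.1 + v.2.1.2 - v.2.2.1, v.1.1 + v.1.2 - v.2.1.1),
    (v.1.1 - v.2.1.1 + v.2.2.2, v.1.1 + v.1.2 - v.2.2.1))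

lemma paramA_injective : Function.Injective paramA := by
  rintro ⟨⟨a, b⟩, ⟨c, d⟩, ⟨e, f⟩⟩ ⟨⟨a', b'⟩, ⟨c', d'⟩, ⟨e', f'⟩⟩ h
  simp only [paramA, Prod.mk.injEq] at h ⊢
  omega

lemma paramC_injective : Function.Injective paramC := by
  rintro ⟨⟨a, b⟩, ⟨c, d⟩, ⟨e, f⟩⟩ ⟨⟨a', b'⟩, ⟨c', d'⟩, ⟨e', f'⟩⟩ h
  simp only [paramC, Prod.mk.injEq] at h ⊢
  omega

lemma mem_range_paramA (x : (ℤ × ℤ) × (ℤ × ℤ) × (ℤ × ℤ)) :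
    diffSum x % 3 = 1 ↔ x ∈ Set.range paramA := by
  constructor
  · intro h
    refine ⟨((diffSum x / 3, x.1.2), x.2.1, x.2.2), ?_⟩
    simp only [diffSum] at h
    ext <;> simp only [paramA, diffSum]
    omega
  · rintro ⟨v, rfl⟩
    simp only [diffSum, paramA]
    omega

lemma mem_range_paramC (x : (ℤ × ℤ) × (ℤ × ℤ) × (ℤ × ℤ)) :
    diffSum x % 3 = 0 ↔ x ∈ Set.range paramC := by
  constructor
  · obtain ⟨⟨a, b⟩, ⟨c, d⟩, ⟨e, f⟩⟩ := x
    intro h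
    simp only [diffSum] at h
    obtain ⟨n, hn⟩ := Int.dvd_of_emod_eq_zero h
    refine ⟨((a, -n), (a - n - d, c - n - f), (a - n - f, e - n - d)), ?_⟩
    simp only [paramC, Prod.mk.injEq, true_and]
    omega
  · rintro ⟨v, rfl⟩
    refine Int.emod_eq_zero_of_dvd ⟨-v.1.2, ?_⟩
    simp only [diffSum, paramC]
    ring

lemma cubeTerm_paramA (τ : ℂ) (v : (ℤ × ℤ) × (ℤ × ℤ) × (ℤ × ℤ)) :
    cubeTerm (termA τ) (paramA v) = cubeTerm (termC τ) (paramC v) := by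
  simp only [cubeTerm, termA, termC, paramA, paramC, ← exp_add]
  congr 1
  push_cast
  ring

lemma classSum_termA_one (τ : ℂ) :
    classSum (cubeTerm (termA τ)) 1 = classSum (cubeTerm (termC τ)) 0 := by
  rw [classSum_eq_tsum_comp paramA_injective mem_range_paramA,
    classSum_eq_tsum_comp paramC_injective mem_range_paramC]
  exact tsum_congr (cubeTerm_paramA τ)

lemma classSum_termA_two (τ : ℂ) :
    classSum (cubeTerm (termA τ)) 1 = classSum (cubeTerm (termA τ)) 2 := by
  refine classSum_eq_of_equiv (Equiv.neg _) (fun x => ?_) fun x => ?_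
  · simp only [diffSum, Equiv.neg_apply, Prod.fst_neg, Prod.snd_neg]
    omega
  · simp [cubeTerm, termA]

/-- Multiplication by `ω` on the coset of the Eisenstein integers that indexes `C3`. -/
def rotate : ℤ × ℤ ≃ ℤ × ℤ where
  toFun p := (p.2, -p.1 - p.2 - 1)
  invFun p := (-p.1 - p.2 - 1, p.1)
  left_inv p := by ext <;> dsimp only; omega
  right_inv p := by ext <;> dsimp only; omega

lemma classSum_termC_add_one (τ : ℂ) {r s : ℤ} (h : ∀ d : ℤ, (d + 1) % 3 = s ↔ d % 3 = r) :
    classSum (cubeTerm (termC τ)) r = classSum (cubeTerm (termC τ)) s := by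
  refine classSum_eq_of_equiv (rotate.prodCongr (Equiv.refl _)) (fun x => ?_) fun x => ?_
  · rw [← h]
    simp only [diffSum, rotate, Equiv.prodCongr_apply, Equiv.coe_fn_mk, Prod.map_fst,
      Prod.map_snd, Equiv.refl_apply]
    omega
  · have : termC τ (rotate x.1) = termC τ x.1 := by
      simp only [termC, rotate, Equiv.coe_fn_mk]
      congr 1
      push_cast
      ring
    simp [cubeTerm, this]

lemma exp_two_pi_div_three_emod (d : ℤ) :
    exp (2 * Real.pi * I * d / 3) = exp (2 * Real.pi * I / 3) ^ (d % 3) := by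
  rw [← exp_int_mul, exp_eq_exp_iff_exists_int]
  refine ⟨d / 3, ?_⟩
  have : (d : ℂ) = (d % 3 : ℤ) + 3 * (d / 3 : ℤ) := by
    exact_mod_cast (Int.emod_add_mul_ediv d 3).symm
  linear_combination (2 * Real.pi * I / 3) * this

lemma A3_pow_three {τ : ℂ} (hτ : 0 < τ.im) :
    A3 τ ^ 3 = classSum (cubeTerm (termA τ)) 0 + 2 * classSum (cubeTerm (termA τ)) 1 := by
  have hs := summable_norm_termA hτ
  have h := tsum_eq_classSum_combination (summable_cubeTerm hs) 1
  simp only [Pi.one_apply, one_mul, ← classSum_termA_two] at h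
  change (∑' p, termA τ p) ^ 3 = _
  rw [tsum_pow_three hs, h]
  ring

lemma C3_pow_three {τ : ℂ} (hτ : 0 < τ.im) :
    C3 τ ^ 3 = 3 * classSum (cubeTerm (termC τ)) 0 := by
  have hs := summable_norm_termC hτ
  have h := tsum_eq_classSum_combination (summable_cubeTerm hs) 1
  rw [← classSum_termC_add_one τ (r := 1) (s := 2) (by omega),
    ← classSum_termC_add_one τ (r := 0) (s := 1) (by omega)] at h
  simp only [Pi.one_apply, one_mul] at h
  change (∑' p, termC τ p) ^ 3 = _
  rw [tsum_pow_three hs, h]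
  ring

lemma B3_pow_three {τ : ℂ} (hτ : 0 < τ.im) :
    B3 τ ^ 3 = classSum (cubeTerm (termA τ)) 0 - classSum (cubeTerm (termA τ)) 1 := by
  set ω := exp (2 * Real.pi * I / 3) with hω
  have hprim : IsPrimitiveRoot ω 3 := by
    simpa using isPrimitiveRoot_exp 3 (by norm_num)
  have hsum : 1 + ω + ω ^ 2 = 0 := by
    simpa [Finset.sum_range_succ] using hprim.geom_sum_eq_zero (by norm_num)
  have hs := summable_norm_termA hτ
  have hB : Summable fun p : ℤ × ℤ =>
      ‖exp (2 * Real.pi * I * ((p.1 : ℂ) - (p.2 : ℂ)) / 3) * termA τ p‖ := by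
    refine hs.congr fun p => ?_
    have : 2 * Real.pi * I * ((p.1 : ℂ) - (p.2 : ℂ)) / 3
        = ((2 * Real.pi * ((p.1 : ℝ) - p.2) / 3 : ℝ) : ℂ) * I := by
      push_cast
      ring
    rw [norm_mul, this, norm_exp_ofReal_mul_I, one_mul]
  have h := tsum_eq_classSum_combination (summable_cubeTerm hs) (fun r => ω ^ r)
  change (∑' p : ℤ × ℤ, exp (2 * Real.pi * I * ((p.1 : ℂ) - (p.2 : ℂ)) / 3) * termA τ p) ^ 3 = _
  have hterm : ∀ x, cubeTerm (fun p : ℤ × ℤ =>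
      exp (2 * Real.pi * I * ((p.1 : ℂ) - (p.2 : ℂ)) / 3) * termA τ p) x
        = ω ^ (diffSum x % 3) * cubeTerm (termA τ) x := fun x => by
    have : exp (2 * Real.pi * I * (diffSum x : ℂ) / 3) =
        exp (2 * Real.pi * I * ((x.1.1 : ℂ) - (x.1.2 : ℂ)) / 3) *
        exp (2 * Real.pi * I * ((x.2.1.1 : ℂ) - (x.2.1.2 : ℂ)) / 3) *
        exp (2 * Real.pi * I * ((x.2.2.1 : ℂ) - (x.2.2.2 : ℂ)) / 3) := by
      rw [← exp_add, ← exp_add]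
      congr 1
      simp only [diffSum]
      push_cast
      ring
    rw [← exp_two_pi_div_three_emod, this]
    simp only [cubeTerm]
    ring
  rw [tsum_pow_three hB, tsum_congr hterm, h, ← classSum_termA_two, zpow_zero, zpow_one,
    zpow_ofNat]
  linear_combination classSum (cubeTerm (termA τ)) 1 * hsum

end BorweinCubic

theorem borwein_cubic_identity (τ : ℂ) (hτ : 0 < τ.im) :
    A3 τ ^ 3 = B3 τ ^ 3 + C3 τ ^ 3 := by
  rw [BorweinCubic.A3_pow_three hτ, BorweinCubic.B3_pow_three hτ, BorweinCubic.C3_pow_three hτ,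
    BorweinCubic.classSum_termA_one]
  ring
end

section
/- For every τ in the complex upper half-plane with Q = exp(2πiτ), the theta series of the hexagonal lattice has the divisor-sum expansion A₃(τ) = 1 + 6·Σ_{n≥1} E₁(n;3)·Qⁿ, where E₁(n;3) = #{d : d | n, d ≡ 1 mod 3} − #{d : d | n, d ≡ 2 mod 3}. -/
/-- `E₁(n;3)`: the number of positive divisors of `n` congruent to `1` mod `3`
minus the number of positive divisors congruent to `2` mod `3`. -/
def E1three (n : ℕ) : ℤ :=
  (((n.divisors).filter fun d => d % 3 = 1).card : ℤ) -
    (((n.divisors).filter fun d => d % 3 = 2).card : ℤ)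

/-- The pairs of integers at which the form `x² + xy + y²` takes the value `n`. -/
def hexReps (n : ℕ) : Set (ℤ × ℤ) :=
  {z | z.1 ^ 2 + z.1 * z.2 + z.2 ^ 2 = (n : ℤ)}

lemma hexReps_subset (n : ℕ) :
    hexReps n ⊆ ((Finset.Icc (-2 * n : ℤ) (2 * n) ×ˢ Finset.Icc (-2 * n : ℤ) (2 * n) :
      Finset (ℤ × ℤ)) : Set (ℤ × ℤ)) := by
  rintro ⟨x, y⟩ h
  simp only [hexReps, Set.mem_ofPred_eq] at h
  simp only [Finset.coe_product, Finset.coe_Icc, Set.mem_prod, Set.mem_Icc]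
  have key : ∀ x y : ℤ, x ^ 2 + x * y + y ^ 2 = n → -2 * n ≤ x ∧ x ≤ 2 * (n : ℤ) := by
    intro x y h
    have h1 : 3 * x ^ 2 ≤ 4 * n := by nlinarith [sq_nonneg (x + 2 * y)]
    have h2 : |x| ≤ x ^ 2 := by
      rw [← sq_abs]
      exact Int.le_self_sq _
    have h3 := abs_le.mp (show |x| ≤ 2 * n by nlinarith [sq_nonneg x])
    constructor <;> linarith [h3.1, h3.2]
  exact ⟨key x y h, key y x (by linarith)⟩

lemma hexReps_finite (n : ℕ) : (hexReps n).Finite :=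
  (Finset.finite_toSet _).subset (hexReps_subset n)

lemma ncard_hexReps_zero : (hexReps 0).ncard = 1 := by
  rw [Set.ncard_eq_one]
  refine ⟨(0, 0), Set.Subset.antisymm (fun z hz => ?_) (by simp [hexReps])⟩
  have := hexReps_subset 0 hz
  simpa using this

lemma ncard_hexReps_one : (hexReps 1).ncard = 6 := by
  have h : hexReps 1 =
      (({(1, 0), (0, 1), (-1, 0), (0, -1), (1, -1), (-1, 1)} : Finset (ℤ × ℤ)) :
        Set (ℤ × ℤ)) := by
    ext ⟨x, y⟩
    constructor
    · intro hz
      have hb := hexReps_subset 1 hz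
      simp only [hexReps, Set.mem_ofPred_eq, Nat.cast_one] at hz
      simp only [Finset.coe_product, Finset.coe_Icc, Set.mem_prod, Set.mem_Icc] at hb
      obtain ⟨⟨h1, h2⟩, h3, h4⟩ := hb
      norm_num at h1 h2 h3 h4
      interval_cases x <;> interval_cases y <;> simp_all
    · intro hz
      simp only [Finset.coe_insert, Finset.coe_singleton, Set.mem_insert_iff, Prod.mk.injEq,
        Set.mem_singleton_iff] at hz
      rcases hz with h | h | h | h | h | h <;> simp [hexReps, h.1, h.2]
  rw [h, Set.ncard_coe_finset]
  rfl

/-- Multiplication by `a + bη` on `ℤ[η]`, where `η² = η - 1`, in the basis `1, η`. -/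
def hexMul (a b : ℤ) (z : ℤ × ℤ) : ℤ × ℤ :=
  (a * z.1 - b * z.2, a * z.2 + b * z.1 + b * z.2)

lemma hexMul_injective {a b : ℤ} (h : a ^ 2 + a * b + b ^ 2 ≠ 0) :
    Function.Injective (hexMul a b) := by
  rintro ⟨x, y⟩ ⟨x', y'⟩ hz
  simp only [hexMul, Prod.mk.injEq] at hz
  obtain ⟨h1, h2⟩ := hz
  ext
  · apply mul_left_cancel₀ h
    linear_combination (a + b) * h1 + b * h2
  · apply mul_left_cancel₀ h
    linear_combination a * h2 - b * h1

lemma hexMul_image {a b : ℤ} {k : ℕ} (hk : k ≠ 0) (h : a ^ 2 + a * b + b ^ 2 = k) (n : ℕ) :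
    hexMul a b '' hexReps n =
      {z ∈ hexReps (k * n) | (k : ℤ) ∣ (a + b) * z.1 + b * z.2 ∧ (k : ℤ) ∣ a * z.2 - b * z.1} := by
  ext ⟨x, y⟩
  simp only [Set.mem_image, Set.mem_ofPred_eq, hexReps, hexMul, Prod.exists, Prod.mk.injEq]
  constructor
  · rintro ⟨u, v, hn, rfl, rfl⟩
    refine ⟨?_, ⟨u, ?_⟩, ⟨v, ?_⟩⟩
    · push_cast
      rw [← h, ← hn]
      ring
    · rw [← h]
      ring
    · rw [← h]
      ring
  · rintro ⟨hn, ⟨u, hu⟩, ⟨v, hv⟩⟩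
    have hk' : (k : ℤ) ≠ 0 := by exact_mod_cast hk
    have hx : a * u - b * v = x := by
      apply mul_left_cancel₀ hk'
      linear_combination x * h - a * hu + b * hv
    have hy : a * v + b * u + b * v = y := by
      apply mul_left_cancel₀ hk'
      linear_combination y * h - (a + b) * hv - b * hu
    refine ⟨u, v, ?_, hx, hy⟩
    apply mul_left_cancel₀ hk'
    push_cast at hn
    rw [← hn, ← hx, ← hy, ← h]
    ring

lemma ncard_hexReps_eq {a b : ℤ} {k : ℕ} (hk : k ≠ 0) (h : a ^ 2 + a * b + b ^ 2 = k) (n : ℕ) :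
    {z ∈ hexReps (k * n) |
      (k : ℤ) ∣ (a + b) * z.1 + b * z.2 ∧ (k : ℤ) ∣ a * z.2 - b * z.1}.ncard =
      (hexReps n).ncard := by
  rw [← hexMul_image hk h, Set.ncard_image_of_injective]
  apply hexMul_injective
  rw [h]
  exact_mod_cast hk

/-- Pairs divisible by `p` in both coordinates. -/
lemma ncard_hexReps_dvd {p : ℕ} (hp : p ≠ 0) (n : ℕ) :
    {z ∈ hexReps (p * (p * n)) | (p : ℤ) ∣ z.1 ∧ (p : ℤ) ∣ z.2}.ncard = (hexReps n).ncard := by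
  rw [← ncard_hexReps_eq (a := p) (b := 0) (k := p * p) (mul_ne_zero hp hp) (by push_cast; ring) n]
  have hp' : (p : ℤ) ≠ 0 := by exact_mod_cast hp
  congr 1
  ext z
  simp [mul_assoc, mul_dvd_mul_iff_left hp']

lemma ncard_hexReps_three_mul (n : ℕ) : (hexReps (3 * n)).ncard = (hexReps n).ncard := by
  rw [← ncard_hexReps_eq (a := 1) (b := 1) (k := 3) (by norm_num) (by norm_num) n]
  congr 1
  ext ⟨x, y⟩
  simp only [hexReps, Set.mem_ofPred_eq, iff_self_and]
  intro h
  have h1 : (3 : ℤ) ∣ (y - x) ^ 2 := ⟨n - x * y, by push_cast at h; linarith⟩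
  have h2 := Int.prime_three.dvd_of_dvd_pow h1
  push_cast
  omega

lemma exists_sq_add_self_add_one {p : ℕ} [Fact p.Prime] (h : p % 3 = 1) :
    ∃ t : ZMod p, t ^ 2 + t + 1 = 0 := by
  have hp := (Fact.out : p.Prime)
  have hdvd : 3 ∣ Fintype.card (ZMod p)ˣ := by
    rw [ZMod.card_units]
    omega
  have : Fact (Nat.Prime 3) := ⟨Nat.prime_three⟩
  obtain ⟨u, hu⟩ := exists_prime_orderOf_dvd_card 3 hdvd
  have h3 : (u : ZMod p) ^ 3 = 1 := by
    rw [← Units.val_pow_eq_pow_val, ← hu, pow_orderOf_eq_one, Units.val_one]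
  have h1 : (u : ZMod p) - 1 ≠ 0 := by
    intro h0
    have : u = 1 := Units.ext (by simpa [sub_eq_zero] using h0)
    simp [this] at hu
  refine ⟨u, mul_left_cancel₀ h1 ?_⟩
  linear_combination h3

lemma dvd_of_dvd_hexForm {p : ℕ} (hp : p.Prime) (h : p % 3 = 2) {x y : ℤ}
    (hd : (p : ℤ) ∣ x ^ 2 + x * y + y ^ 2) : (p : ℤ) ∣ x ∧ (p : ℤ) ∣ y := by
  have : Fact p.Prime := ⟨hp⟩
  have key : ∀ x y : ZMod p, x ^ 2 + x * y + y ^ 2 = 0 → y = 0 := by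
    intro x y hxy
    by_contra hy
    have ht : (x / y) ^ 2 + x / y + 1 = 0 := by
      field_simp
      linear_combination hxy
    set t := x / y
    have h3 : t ^ 3 = 1 := by linear_combination (t - 1) * ht
    have ht0 : t ≠ 0 := by
      intro h0
      simp [h0] at ht
    have hpow := ZMod.pow_card_sub_one_eq_one ht0
    have ht1 : t = 1 := by
      have hp1 : p - 1 = 3 * (p / 3) + 1 := by omega
      rwa [hp1, pow_succ, pow_mul, h3, one_pow, one_mul] at hpow
    rw [ht1] at ht
    have h30 : ((3 : ℕ) : ZMod p) = 0 := by
      push_cast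
      linear_combination ht
    rw [ZMod.natCast_eq_zero_iff, Nat.prime_dvd_prime_iff_eq hp Nat.prime_three] at h30
    omega
  have hz : (x : ZMod p) ^ 2 + x * y + (y : ZMod p) ^ 2 = 0 := by
    have := (ZMod.intCast_zmod_eq_zero_iff_dvd _ p).mpr hd
    exact_mod_cast this
  simp only [← ZMod.intCast_zmod_eq_zero_iff_dvd]
  exact ⟨key y x (by linear_combination hz), key x y hz⟩

/-- A prime congruent to `1` modulo `3` is represented by the form `x² + xy + y²`. -/
lemma exists_hexForm_eq_prime {p : ℕ} (hp : p.Prime) (h : p % 3 = 1) :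
    ∃ a b : ℤ, a ^ 2 + a * b + b ^ 2 = p := by
  have : Fact p.Prime := ⟨hp⟩
  obtain ⟨t, ht⟩ := exists_sq_add_self_add_one h
  let s := p.sqrt
  have hcard : (Finset.univ : Finset (ZMod p)).card <
      (Finset.range (s + 1) ×ˢ Finset.range (s + 1)).card := by
    simp only [Finset.card_univ, ZMod.card, Finset.card_product, Finset.card_range]
    exact Nat.lt_succ_sqrt p
  obtain ⟨⟨x, y⟩, hxy, ⟨x', y'⟩, hxy', hne, heq⟩ :=
    Finset.exists_ne_map_eq_of_card_lt_of_maps_to hcard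
      (f := fun z => (z.1 : ZMod p) - t * z.2) (fun _ _ => Finset.mem_univ _)
  simp only [Finset.mem_product, Finset.mem_range, Nat.lt_succ_iff] at hxy hxy'
  have hs : s ^ 2 < p := by
    refine lt_of_le_of_ne (Nat.sqrt_le' p) fun he => ?_
    exact hp.prime.not_isSquare ⟨s, by rw [← he, sq]⟩
  set a : ℤ := x - x' with ha
  set b : ℤ := y - y' with hb
  have hab : ∀ u v : ℕ, u ≤ s → v ≤ s → ((u : ℤ) - v) ^ 2 < p := by
    intro u v hu hv
    have h1 : |(u : ℤ) - v| ≤ s := abs_le.mpr (by constructor <;> linarith)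
    calc ((u : ℤ) - v) ^ 2 ≤ (s : ℤ) ^ 2 := sq_le_sq' (abs_le.mp h1).1 (abs_le.mp h1).2
      _ < p := by exact_mod_cast hs
  have ha2 : a ^ 2 < p := hab x x' hxy.1 hxy'.1
  have hb2 : b ^ 2 < p := hab y y' hxy.2 hxy'.2
  have hdvd : (p : ℤ) ∣ a ^ 2 + a * b + b ^ 2 := by
    rw [← ZMod.intCast_zmod_eq_zero_iff_dvd]
    have hat : (a : ZMod p) = t * b := by
      simp only [ha, hb]
      push_cast
      linear_combination heq
    push_cast
    rw [hat]
    linear_combination (b : ZMod p) ^ 2 * ht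
  have hpos : 0 < a ^ 2 + a * b + b ^ 2 := by
    by_contra hle
    have hb0 : b = 0 := by
      have : b ^ 2 = 0 := by nlinarith [sq_nonneg (2 * a + b), sq_nonneg b]
      exact pow_eq_zero_iff two_ne_zero |>.mp this
    have ha0 : a = 0 := by
      have : a ^ 2 = 0 := by nlinarith [sq_nonneg (2 * b + a), sq_nonneg a]
      exact pow_eq_zero_iff two_ne_zero |>.mp this
    apply hne
    ext <;> simp only <;> omega
  obtain ⟨m, hm⟩ := hdvd
  have hp0 : (0 : ℤ) < p := by exact_mod_cast hp.pos
  have hm0 : 0 < m := by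
    by_contra hle
    nlinarith
  have hm3 : m < 3 := by
    by_contra hle
    nlinarith [sq_nonneg (a - b)]
  have hm' : m = 1 ∨ m = 2 := by omega
  rcases hm' with rfl | rfl
  · exact ⟨a, b, by linarith⟩
  · exfalso
    obtain ⟨⟨u, hu⟩, ⟨v, hv⟩⟩ := dvd_of_dvd_hexForm Nat.prime_two rfl
      (x := a) (y := b) ⟨p, by rw [hm]; push_cast; ring⟩
    push_cast at hu hv
    rw [hu, hv] at hm
    have h2 : (2 : ℤ) ∣ p := ⟨u ^ 2 + u * v + v ^ 2, by linarith⟩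
    have := (Nat.prime_dvd_prime_iff_eq Nat.prime_two hp).mp (by exact_mod_cast h2)
    omega

lemma ncard_hexReps_split {p : ℕ} (hp : p.Prime) (h : p % 3 = 1) (n : ℕ) :
    (hexReps (p * n)).ncard + {z ∈ hexReps (p * n) | (p : ℤ) ∣ z.1 ∧ (p : ℤ) ∣ z.2}.ncard =
      2 * (hexReps n).ncard := by
  obtain ⟨a, b, hab⟩ := exists_hexForm_eq_prime hp h
  have hpi : Prime (p : ℤ) := Nat.prime_iff_prime_int.mp hp
  have hpb : ¬ (p : ℤ) ∣ b := by
    rintro ⟨c, rfl⟩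
    have ha : (p : ℤ) ∣ a := by
      apply hpi.dvd_of_dvd_pow (n := 2)
      exact ⟨1 - a * c - p * c ^ 2, by linear_combination hab⟩
    obtain ⟨d, rfl⟩ := ha
    apply hpi.not_isUnit
    apply isUnit_of_dvd_one
    refine ⟨d ^ 2 + d * c + c ^ 2, mul_left_cancel₀ hpi.ne_zero ?_⟩
    linear_combination -hab
  have hpab : ¬ (p : ℤ) ∣ 2 * a + b := by
    rintro ⟨c, hc⟩
    have h3 : (p : ℤ) ∣ 3 * b ^ 2 :=
      ⟨4 - p * c ^ 2, by linear_combination 4 * hab - (2 * a + b + p * c) * hc⟩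
    rcases hpi.dvd_or_dvd h3 with h3 | h3
    · have := (Nat.prime_dvd_prime_iff_eq hp Nat.prime_three).mp (by exact_mod_cast h3)
      omega
    · exact hpb (hpi.dvd_of_dvd_pow h3)
  set A := {z ∈ hexReps (p * n) |
    (p : ℤ) ∣ (a + b) * z.1 + b * z.2 ∧ (p : ℤ) ∣ a * z.2 - b * z.1} with hA
  set B := {z ∈ hexReps (p * n) | (p : ℤ) ∣ ((a + b) + (-b)) * z.1 + (-b) * z.2 ∧
    (p : ℤ) ∣ (a + b) * z.2 - (-b) * z.1} with hB
  have hAc : A.ncard = (hexReps n).ncard := ncard_hexReps_eq hp.ne_zero hab n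
  have hBc : B.ncard = (hexReps n).ncard :=
    ncard_hexReps_eq hp.ne_zero (by linear_combination hab) n
  have hunion : A ∪ B = hexReps (p * n) := by
    refine Set.Subset.antisymm (Set.union_subset (Set.sep_subset _ _) (Set.sep_subset _ _)) ?_
    rintro ⟨x, y⟩ hz
    have hz' : x ^ 2 + x * y + y ^ 2 = p * n := by simpa [hexReps] using hz
    have hprod : (p : ℤ) ∣ (a * y - b * x) * ((a + b) * y - (-b) * x) :=
      ⟨y ^ 2 - b ^ 2 * n, by linear_combination y ^ 2 * hab - b ^ 2 * hz'⟩
    rcases hpi.dvd_or_dvd hprod with hd | hd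
    · refine Or.inl ⟨hz, ?_, hd⟩
      refine (hpi.dvd_or_dvd (a := b) ?_).resolve_left hpb
      obtain ⟨c, hc⟩ := hd
      exact ⟨y - (a + b) * c, by linear_combination y * hab - (a + b) * hc⟩
    · refine Or.inr ⟨hz, ?_, hd⟩
      refine (hpi.dvd_or_dvd (a := b) ?_).resolve_left hpb
      obtain ⟨c, hc⟩ := hd
      exact ⟨a * c - y, by linear_combination a * hc - y * hab⟩
  have hinter : A ∩ B = {z ∈ hexReps (p * n) | (p : ℤ) ∣ z.1 ∧ (p : ℤ) ∣ z.2} := by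
    ext ⟨x, y⟩
    constructor
    · rintro ⟨⟨hz, h1, -⟩, ⟨-, h2, -⟩⟩
      have hx : (p : ℤ) ∣ x := by
        refine (hpi.dvd_or_dvd (a := 2 * a + b) ?_).resolve_left hpab
        convert dvd_add h1 h2 using 1
        ring
      refine ⟨hz, hx, ?_⟩
      refine (hpi.dvd_or_dvd (a := b) ?_).resolve_left hpb
      exact (dvd_add_right (hx.mul_left _)).mp h1
    · rintro ⟨hz, hx, hy⟩
      exact ⟨⟨hz, dvd_add (hx.mul_left _) (hy.mul_left _), dvd_sub (hy.mul_left _) (hx.mul_left _)⟩,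
        ⟨hz, dvd_add (hx.mul_left _) (hy.mul_left _), dvd_sub (hy.mul_left _) (hx.mul_left _)⟩⟩
  have := Set.ncard_union_add_ncard_inter A B ((hexReps_finite _).subset (Set.sep_subset _ _))
    ((hexReps_finite _).subset (Set.sep_subset _ _))
  rw [hunion, hinter, hAc, hBc] at this
  linarith

lemma hexReps_dvd_eq_empty {p n : ℕ} (hp : p.Prime) (hn : ¬ p ∣ n) :
    {z ∈ hexReps (p * n) | (p : ℤ) ∣ z.1 ∧ (p : ℤ) ∣ z.2} = ∅ := by
  rw [Set.eq_empty_iff_forall_notMem]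
  rintro ⟨x, y⟩ ⟨hz, ⟨u, rfl⟩, ⟨v, rfl⟩⟩
  apply hn
  have hp0 : (p : ℤ) ≠ 0 := by exact_mod_cast hp.ne_zero
  have hd : (p : ℤ) ∣ n := by
    refine ⟨u ^ 2 + u * v + v ^ 2, mul_left_cancel₀ hp0 ?_⟩
    simp only [hexReps, Set.mem_ofPred_eq, Nat.cast_mul] at hz
    linear_combination -hz
  exact_mod_cast hd

lemma hexReps_inert {p : ℕ} (hp : p.Prime) (h : p % 3 = 2) (n : ℕ) :
    hexReps (p * n) = {z ∈ hexReps (p * n) | (p : ℤ) ∣ z.1 ∧ (p : ℤ) ∣ z.2} := by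
  refine (Set.sep_eq_self_iff_mem_true.mpr fun z hz => dvd_of_dvd_hexForm hp h ⟨n, ?_⟩).symm
  simpa [hexReps] using hz

/-- The non-principal character modulo `3`. -/
def chiThree (n : ℕ) : ℤ := if n % 3 = 1 then 1 else if n % 3 = 2 then -1 else 0

lemma chiThree_mul (m n : ℕ) : chiThree (m * n) = chiThree m * chiThree n := by
  have hm : m % 3 = 0 ∨ m % 3 = 1 ∨ m % 3 = 2 := by omega
  have hn : n % 3 = 0 ∨ n % 3 = 1 ∨ n % 3 = 2 := by omega
  simp only [chiThree, Nat.mul_mod m n 3]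
  rcases hm with hm | hm | hm <;> rcases hn with hn | hn | hn <;> simp [hm, hn]

lemma E1three_eq_sum (n : ℕ) : E1three n = ∑ d ∈ n.divisors, chiThree d := by
  rw [E1three, Finset.card_filter, Finset.card_filter]
  push_cast
  rw [← Finset.sum_sub_distrib]
  refine Finset.sum_congr rfl fun d _ => ?_
  unfold chiThree
  split_ifs <;> omega

lemma E1three_prime_mul {p n : ℕ} (hp : p.Prime) (hn : n ≠ 0) :
    E1three (p * n) + ∑ d ∈ n.divisors with p ∣ d, chiThree d =
      (1 + chiThree p) * E1three n := by
  have hunion : (p * n).divisors = n.divisors ∪ n.divisors.image (p * ·) := by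
    rw [Nat.divisors_mul, hp.divisors]
    ext d
    simp [Finset.mem_mul]
  have hinter : n.divisors ∩ n.divisors.image (p * ·) = {d ∈ n.divisors | p ∣ d} := by
    ext d
    simp only [Finset.mem_inter, Finset.mem_image, Finset.mem_filter, Nat.mem_divisors]
    constructor
    · rintro ⟨hd, e, -, rfl⟩
      exact ⟨hd, dvd_mul_right _ _⟩
    · rintro ⟨hd, e, rfl⟩
      exact ⟨hd, e, ⟨(dvd_mul_left _ _).trans hd.1, hn⟩, rfl⟩
  have hsum : ∑ d ∈ n.divisors.image (p * ·), chiThree d = chiThree p * E1three n := by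
    rw [Finset.sum_image fun _ _ _ _ h => Nat.eq_of_mul_eq_mul_left hp.pos h, E1three_eq_sum,
      Finset.mul_sum]
    simp only [chiThree_mul]
  rw [E1three_eq_sum (p * n), hunion, ← hinter, Finset.sum_union_inter, hsum, ← E1three_eq_sum]
  ring

lemma E1three_prime_mul_of_not_dvd {p n : ℕ} (hp : p.Prime) (hn : ¬ p ∣ n) :
    E1three (p * n) = (1 + chiThree p) * E1three n := by
  rw [← E1three_prime_mul hp (by rintro rfl; simp at hn), Finset.filter_eq_empty_iff.mpr]
  · simp
  · exact fun d hd hpd => hn (hpd.trans (Nat.dvd_of_mem_divisors hd))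

lemma E1three_prime_mul_prime_mul {p n : ℕ} (hp : p.Prime) (hn : n ≠ 0) :
    E1three (p * (p * n)) + chiThree p * E1three n = (1 + chiThree p) * E1three (p * n) := by
  rw [← E1three_prime_mul hp (mul_ne_zero hp.ne_zero hn)]
  have hfilter : {d ∈ (p * n).divisors | p ∣ d} = n.divisors.image (p * ·) := by
    ext d
    simp only [Finset.mem_image, Finset.mem_filter, Nat.mem_divisors]
    constructor
    · rintro ⟨⟨hd, -⟩, e, rfl⟩
      exact ⟨e, ⟨Nat.dvd_of_mul_dvd_mul_left hp.pos hd, hn⟩, rfl⟩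
    · rintro ⟨e, ⟨he, -⟩, rfl⟩
      exact ⟨⟨mul_dvd_mul_left p he, mul_ne_zero hp.ne_zero hn⟩, dvd_mul_right _ _⟩
  rw [hfilter, Finset.sum_image fun _ _ _ _ h => Nat.eq_of_mul_eq_mul_left hp.pos h,
    E1three_eq_sum n, Finset.mul_sum]
  simp only [chiThree_mul]

/-- The number of representations of `n ≥ 1` by the form `x² + xy + y²` is `6 E₁(n;3)`. -/
theorem ncard_hexReps {n : ℕ} (hn : n ≠ 0) : ((hexReps n).ncard : ℤ) = 6 * E1three n := by
  induction n using Nat.strong_induction_on with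
  | _ n ih =>
    by_cases h1 : n = 1
    · subst h1
      rw [ncard_hexReps_one]
      rfl
    obtain ⟨p, hp, m, rfl⟩ := Nat.exists_prime_and_dvd h1
    have hm : m ≠ 0 := right_ne_zero_of_mul hn
    have hlt : m < p * m := lt_mul_of_one_lt_left (Nat.pos_of_ne_zero hm) hp.one_lt
    have ihm := ih m hlt hm
    have hp3 : p % 3 = 0 ∨ p % 3 = 1 ∨ p % 3 = 2 := by omega
    by_cases hpm : p ∣ m
    · obtain ⟨k, rfl⟩ := hpm
      have hk : k ≠ 0 := right_ne_zero_of_mul hm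
      have ihk := ih k ((lt_mul_of_one_lt_left (Nat.pos_of_ne_zero hk) hp.one_lt).trans hlt) hk
      have hE := E1three_prime_mul_prime_mul hp hk
      rcases hp3 with h | h | h
      · obtain rfl : 3 = p :=
          (Nat.prime_dvd_prime_iff_eq Nat.prime_three hp).mp (Nat.dvd_of_mod_eq_zero h)
        rw [ncard_hexReps_three_mul, ihm]
        simp [chiThree] at hE
        rw [hE]
      · have hr := ncard_hexReps_split hp h (p * k)
        rw [ncard_hexReps_dvd hp.ne_zero] at hr
        simp only [chiThree, h] at hE
        zify at hr
        norm_num at hE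
        linarith
      · rw [hexReps_inert hp h, ncard_hexReps_dvd hp.ne_zero, ihk]
        simp only [chiThree, h] at hE
        norm_num at hE
        linarith
    · have hE := E1three_prime_mul_of_not_dvd hp hpm
      rcases hp3 with h | h | h
      · obtain rfl : 3 = p :=
          (Nat.prime_dvd_prime_iff_eq Nat.prime_three hp).mp (Nat.dvd_of_mod_eq_zero h)
        rw [ncard_hexReps_three_mul, ihm, hE]
        simp [chiThree]
      · have hr := ncard_hexReps_split hp h m
        rw [hexReps_dvd_eq_empty hp hpm, Set.ncard_empty] at hr
        simp only [chiThree, h] at hE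
        zify at hr
        norm_num at hE
        linarith
      · rw [hexReps_inert hp h, hexReps_dvd_eq_empty hp hpm, hE]
        simp [chiThree, h]

/-- The value of the form `x² + xy + y²`, as a natural number. -/
def hexNorm (z : ℤ × ℤ) : ℕ := (z.1 ^ 2 + z.1 * z.2 + z.2 ^ 2).toNat

lemma coe_hexNorm (z : ℤ × ℤ) : (hexNorm z : ℤ) = z.1 ^ 2 + z.1 * z.2 + z.2 ^ 2 :=
  Int.toNat_of_nonneg (by nlinarith [sq_nonneg (z.1 + z.2), sq_nonneg z.1, sq_nonneg z.2])

lemma hexNorm_preimage (n : ℕ) : hexNorm ⁻¹' {n} = hexReps n := by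
  ext z
  simp only [Set.mem_preimage, Set.mem_singleton_iff, hexReps, Set.mem_ofPred_eq, ← coe_hexNorm,
    Nat.cast_inj]

lemma natAbs_add_natAbs_le_two_mul_hexNorm (z : ℤ × ℤ) :
    z.1.natAbs + z.2.natAbs ≤ 2 * hexNorm z := by
  zify
  rw [coe_hexNorm]
  have h : ∀ x : ℤ, |x| ≤ x ^ 2 := fun x => by
    rw [← sq_abs]
    exact Int.le_self_sq _
  nlinarith [h z.1, h z.2, sq_nonneg (z.1 + z.2)]

lemma summable_pow_natAbs {r : ℝ} (h0 : 0 ≤ r) (h1 : r < 1) :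
    Summable fun x : ℤ => r ^ x.natAbs := by
  apply Summable.of_nat_of_neg <;> simpa using summable_geometric_of_lt_one h0 h1

lemma summable_pow_hexNorm {q : ℂ} (hq : ‖q‖ < 1) : Summable fun z => q ^ hexNorm z := by
  set r := √‖q‖ with hr
  have h0 : 0 ≤ r := Real.sqrt_nonneg _
  have h1 : r < 1 := by
    rw [hr, Real.sqrt_lt' one_pos]
    simpa using hq
  have hs := summable_pow_natAbs h0 h1
  refine Summable.of_norm_bounded (hs.mul_of_nonneg hs (fun _ => pow_nonneg h0 _)
    (fun _ => pow_nonneg h0 _)) fun z => ?_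
  rw [norm_pow, ← Real.sq_sqrt (norm_nonneg q), ← hr, ← pow_mul, ← pow_add]
  exact pow_le_pow_of_le_one h0 h1.le (natAbs_add_natAbs_le_two_mul_hexNorm z)

lemma hasSum_ncard_hexReps {q : ℂ} (hq : ‖q‖ < 1) :
    HasSum (fun n => ((hexReps n).ncard : ℂ) * q ^ n) (∑' z, q ^ hexNorm z) := by
  have h : (fun n => ((hexReps n).ncard : ℂ) * q ^ n) =
      fun n => ∑' z : hexNorm ⁻¹' {n}, q ^ hexNorm z := by
    funext n
    have hz (z : hexNorm ⁻¹' {n}) : q ^ hexNorm z = q ^ n := by rw [z.2]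
    rw [tsum_congr hz, tsum_const, hexNorm_preimage, nsmul_eq_mul, Nat.card_coe_set_eq]
  rw [h]
  exact (summable_pow_hexNorm hq).hasSum.tsum_fiberwise hexNorm

theorem A3_divisor_sum_expansion (τ : ℂ) (hτ : 0 < τ.im) :
    A3 τ = 1 + 6 * ∑' n : ℕ, (E1three (n + 1) : ℂ) *
      Complex.exp (2 * Real.pi * Complex.I * ((n : ℂ) + 1) * τ) := by
  set q := Complex.exp (2 * Real.pi * Complex.I * τ) with hq
  have hq1 : ‖q‖ < 1 := by
    rw [hq, Complex.norm_exp]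
    simpa using mul_pos Real.two_pi_pos hτ
  have hA : A3 τ = ∑' z, q ^ hexNorm z := by
    refine tsum_congr fun z => ?_
    have h : ((hexNorm z : ℕ) : ℂ) = (z.1 : ℂ) ^ 2 + z.1 * z.2 + (z.2 : ℂ) ^ 2 := by
      exact_mod_cast congrArg (Int.cast : ℤ → ℂ) (coe_hexNorm z)
    rw [hq, ← Complex.exp_nat_mul, h]
    congr 1
    ring
  have hs := hasSum_ncard_hexReps hq1
  rw [hA, ← hs.tsum_eq, hs.summable.tsum_eq_zero_add, ncard_hexReps_zero, ← tsum_mul_left]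
  congr 1
  · simp
  · refine tsum_congr fun n => ?_
    have h : ((hexReps (n + 1)).ncard : ℂ) = 6 * (E1three (n + 1) : ℂ) := by
      exact_mod_cast congrArg (Int.cast : ℤ → ℂ) (ncard_hexReps n.succ_ne_zero)
    rw [h, hq, ← Complex.exp_nat_mul, mul_assoc]
    congr 3
    push_cast
    ring
end

section
/- For every τ in the complex upper half-plane, the trisection identities for the Borwein theta functions hold: A₃(τ/3) = A₃(τ) + 2·C₃(τ) and B₃(τ/3) = A₃(τ) − C₃(τ). In particular C₃(τ) = (1/2)(A₃(τ/3) − A₃(τ)). -/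
/-- The points of `ℤ × ℤ`, split into three copies of `ℤ × ℤ` according to the residue of the
difference of the coordinates modulo `3`. -/
def trisection : (ℤ × ℤ) ⊕ (ℤ × ℤ) ⊕ (ℤ × ℤ) → ℤ × ℤ :=
  Sum.elim (fun p => (p.1 - p.2, p.1 + 2 * p.2))
    (Sum.elim (fun p => (p.1 - p.2, p.1 + 2 * p.2 + 1)) (fun p => (p.1 + 2 * p.2 + 1, p.1 - p.2)))

theorem trisection_bijective : Function.Bijective trisection := by
  constructor
  · rintro (⟨a, b⟩ | ⟨a, b⟩ | ⟨a, b⟩) (⟨c, d⟩ | ⟨c, d⟩ | ⟨c, d⟩) h <;>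
      simp only [trisection, Sum.elim_inl, Sum.elim_inr, Prod.mk.injEq, Sum.inl.injEq,
        Sum.inr.injEq, reduceCtorEq] at h ⊢ <;> omega
  · rintro ⟨m, n⟩
    have h : (n - m) % 3 = 0 ∨ (n - m) % 3 = 1 ∨ (n - m) % 3 = 2 := by omega
    rcases h with h | h | h
    · refine ⟨Sum.inl (m + (n - m) / 3, (n - m) / 3), ?_⟩
      simp only [trisection, Sum.elim_inl, Prod.mk.injEq]
      omega
    · refine ⟨Sum.inr (Sum.inl (m + (n - m) / 3, (n - m) / 3)), ?_⟩
      simp only [trisection, Sum.elim_inl, Sum.elim_inr, Prod.mk.injEq]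
      omega
    · refine ⟨Sum.inr (Sum.inr (n + (m - n) / 3, (m - n) / 3)), ?_⟩
      simp only [trisection, Sum.elim_inr, Prod.mk.injEq]
      omega

theorem tsum_trisection {f : ℤ × ℤ → ℂ} (hf : Summable f) :
    ∑' p, f p = ∑' p : ℤ × ℤ, f (p.1 - p.2, p.1 + 2 * p.2) +
      (∑' p : ℤ × ℤ, f (p.1 - p.2, p.1 + 2 * p.2 + 1) +
        ∑' p : ℤ × ℤ, f (p.1 + 2 * p.2 + 1, p.1 - p.2)) := by
  have h : Summable (f ∘ trisection) := hf.comp_injective trisection_bijective.injective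
  have hr : Summable ((f ∘ trisection) ∘ Sum.inr) := h.comp_injective Sum.inr_injective
  rw [← (Equiv.ofBijective _ trisection_bijective).tsum_eq f]
  exact (Summable.tsum_sum (h.comp_injective Sum.inl_injective) hr).trans
    (congrArg _ (Summable.tsum_sum (hr.comp_injective Sum.inl_injective)
      (hr.comp_injective Sum.inr_injective)))

theorem summable_exp_neg_mul_int_sq {c : ℝ} (hc : 0 < c) :
    Summable fun n : ℤ => Real.exp (-c * (n : ℝ) ^ 2) := by
  have h := ((summable_jacobiTheta₂_term_iff 0 ((c / Real.pi : ℝ) * Complex.I)).2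
    (by simpa using by positivity)).norm
  refine h.congr fun n => ?_
  rw [norm_jacobiTheta₂_term]
  congr 1
  simp
  field_simp

theorem norm_exp_eisenstein_form (τ : ℂ) (p : ℤ × ℤ) :
    ‖Complex.exp (2 * Real.pi * Complex.I *
      ((p.1 : ℂ) ^ 2 + (p.1 : ℂ) * (p.2 : ℂ) + (p.2 : ℂ) ^ 2) * τ)‖ =
      Real.exp (-(2 * Real.pi * τ.im) * ((p.1 : ℝ) ^ 2 + p.1 * p.2 + (p.2 : ℝ) ^ 2)) := by
  have h : 2 * Real.pi * Complex.I *
      ((p.1 : ℂ) ^ 2 + (p.1 : ℂ) * (p.2 : ℂ) + (p.2 : ℂ) ^ 2) * τ =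
      ((2 * Real.pi * ((p.1 : ℝ) ^ 2 + p.1 * p.2 + (p.2 : ℝ) ^ 2) : ℝ) : ℂ) *
        (Complex.I * τ) := by
    push_cast; ring
  rw [Complex.norm_exp, h, Complex.re_ofReal_mul, Complex.I_mul_re]
  congr 1
  ring

theorem summable_exp_eisenstein_form {τ : ℂ} (hτ : 0 < τ.im) :
    Summable fun p : ℤ × ℤ => Complex.exp (2 * Real.pi * Complex.I *
      ((p.1 : ℂ) ^ 2 + (p.1 : ℂ) * (p.2 : ℂ) + (p.2 : ℂ) ^ 2) * τ) := by
  have hc : 0 < Real.pi * τ.im := by positivity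
  have h := summable_exp_neg_mul_int_sq hc
  refine Summable.of_norm_bounded (h.mul_of_nonneg h (fun _ => (Real.exp_pos _).le)
    fun _ => (Real.exp_pos _).le) fun p => ?_
  rw [norm_exp_eisenstein_form, ← Real.exp_add, Real.exp_le_exp]
  nlinarith [mul_nonneg hc.le (sq_nonneg ((p.1 : ℝ) + p.2))]

theorem summable_phase_mul_exp_eisenstein_form {τ : ℂ} (hτ : 0 < τ.im) :
    Summable fun p : ℤ × ℤ =>
      Complex.exp (2 * Real.pi * Complex.I * ((p.1 : ℂ) - (p.2 : ℂ)) / 3) *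
      Complex.exp (2 * Real.pi * Complex.I *
      ((p.1 : ℂ) ^ 2 + (p.1 : ℂ) * (p.2 : ℂ) + (p.2 : ℂ) ^ 2) * τ) := by
  refine Summable.of_norm_bounded (summable_exp_eisenstein_form hτ).norm fun p => ?_
  have h : 2 * Real.pi * Complex.I * ((p.1 : ℂ) - (p.2 : ℂ)) / 3 =
      ((2 * Real.pi * ((p.1 : ℝ) - p.2) / 3 : ℝ) : ℂ) * Complex.I := by
    push_cast; ring
  rw [norm_mul, h, Complex.norm_exp_ofReal_mul_I, one_mul]

theorem exp_two_pi_I_mul_int_add (n : ℤ) (z : ℂ) :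
    Complex.exp (2 * Real.pi * Complex.I * n + z) = Complex.exp z := by
  rw [Complex.exp_add, mul_comm _ (n : ℂ), Complex.exp_int_mul_two_pi_mul_I, one_mul]

theorem exp_neg_two_pi_I_div_three_add_exp_two_pi_I_div_three :
    Complex.exp (-(2 * Real.pi * Complex.I / 3)) + Complex.exp (2 * Real.pi * Complex.I / 3) =
      -1 := by
  have h := (Complex.isPrimitiveRoot_exp 3 (by norm_num)).geom_sum_eq_zero (by norm_num)
  have hs : Complex.exp (2 * Real.pi * Complex.I / 3) ^ 2 =
      Complex.exp (-(2 * Real.pi * Complex.I / 3)) := by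
    rw [← Complex.exp_nat_mul, ← exp_two_pi_I_mul_int_add (-1)]
    congr 1
    push_cast; ring
  simp only [Finset.sum_range_succ, Finset.sum_range_zero, Nat.cast_ofNat, pow_zero, pow_one,
    hs] at h
  linear_combination h

theorem A3_div_three {τ : ℂ} (hτ : 0 < τ.im) : A3 (τ / 3) = A3 τ + 2 * C3 τ := by
  have h3 : 0 < (τ / 3).im := by
    rw [Complex.div_ofNat_im]; positivity
  rw [A3, tsum_trisection (summable_exp_eisenstein_form h3), two_mul (C3 τ), A3, C3]
  refine congrArg₂ _ (tsum_congr fun p => ?_)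
    (congrArg₂ _ (tsum_congr fun p => ?_) (tsum_congr fun p => ?_)) <;>
  · congr 1
    push_cast
    ring

theorem B3_div_three {τ : ℂ} (hτ : 0 < τ.im) : B3 (τ / 3) = A3 τ - C3 τ := by
  have h3 : 0 < (τ / 3).im := by
    rw [Complex.div_ofNat_im]; positivity
  have hC : A3 τ - C3 τ = A3 τ + (Complex.exp (-(2 * Real.pi * Complex.I / 3)) * C3 τ +
      Complex.exp (2 * Real.pi * Complex.I / 3) * C3 τ) := by
    linear_combination -C3 τ * exp_neg_two_pi_I_div_three_add_exp_two_pi_I_div_three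
  rw [hC, B3, tsum_trisection (summable_phase_mul_exp_eisenstein_form h3), A3, C3,
    ← tsum_mul_left, ← tsum_mul_left]
  refine congrArg₂ _ (tsum_congr fun p => ?_)
    (congrArg₂ _ (tsum_congr fun p => ?_) (tsum_congr fun p => ?_))
  · rw [← Complex.exp_add, ← exp_two_pi_I_mul_int_add p.2]
    congr 1
    push_cast; ring
  · rw [← Complex.exp_add, ← Complex.exp_add, ← exp_two_pi_I_mul_int_add p.2]
    congr 1
    push_cast; ring
  · rw [← Complex.exp_add, ← Complex.exp_add, ← exp_two_pi_I_mul_int_add (-p.2)]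
    congr 1
    push_cast; ring

theorem borwein_trisection_identities (τ : ℂ) (hτ : 0 < τ.im) :
    A3 (τ / 3) = A3 τ + 2 * C3 τ ∧
    B3 (τ / 3) = A3 τ - C3 τ ∧
    C3 τ = (1 / 2) * (A3 (τ / 3) - A3 τ) := by
  refine ⟨A3_div_three hτ, B3_div_three hτ, ?_⟩
  rw [A3_div_three hτ]
  ring
end

section
/- For every τ in the complex upper half-plane, the hexagonal lattice theta function factors as a sum of products of Jacobi theta constants: A₃(τ) = θ₂(2τ)·θ₂(6τ) + θ₃(2τ)·θ₃(6τ). -/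
/-- The lattice `ℤ²` split by the parity of the second coordinate, in coordinates in which
`m² + mn + n²` is diagonal: `(m, n) = (a - k, 2k)` or `(m, n) = (a - k, 2k + 1)`. -/
def hexLatticeParityEquiv : (ℤ × ℤ) ⊕ (ℤ × ℤ) ≃ ℤ × ℤ where
  toFun := Sum.elim (fun p ↦ (p.1 - p.2, 2 * p.2)) (fun p ↦ (p.1 - p.2, 2 * p.2 + 1))
  invFun q := if q.2 % 2 = 0 then .inl (q.1 + q.2 / 2, q.2 / 2) else .inr (q.1 + q.2 / 2, q.2 / 2)
  left_inv := by
    rintro (⟨a, k⟩ | ⟨a, k⟩)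
    · simp
    · have h : (2 * k + 1) / 2 = k := by omega
      simp [h]
  right_inv := by
    rintro ⟨m, n⟩
    dsimp only
    split_ifs with h <;> ext <;> simp <;> omega

lemma summable_theta3_term {τ : ℂ} (hτ : 0 < τ.im) :
    Summable fun n : ℤ ↦ Complex.exp (Real.pi * Complex.I * (n : ℂ) ^ 2 * τ) :=
  ((summable_jacobiTheta₂_term_iff 0 τ).mpr hτ).congr fun n ↦ by simp [jacobiTheta₂_term]

lemma summable_theta2_term {τ : ℂ} (hτ : 0 < τ.im) :
    Summable fun n : ℤ ↦ Complex.exp (Real.pi * Complex.I * ((n : ℂ) + 1 / 2) ^ 2 * τ) :=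
  (((summable_jacobiTheta₂_term_iff (τ / 2) τ).mpr hτ).mul_left
    (Complex.exp (Real.pi * Complex.I * τ / 4))).congr fun n ↦ by
      rw [jacobiTheta₂_term, ← Complex.exp_add]
      ring_nf

lemma hasSum_mul_tsum {ι ι' : Type*} {f : ι → ℂ} {g : ι' → ℂ} (hf : Summable f)
    (hg : Summable g) :
    HasSum (fun p : ι × ι' ↦ f p.1 * g p.2) ((∑' i, f i) * ∑' j, g j) := by
  rw [tsum_mul_tsum_of_summable_norm hf.norm hg.norm]
  exact (summable_mul_of_summable_norm hf.norm hg.norm).hasSum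

lemma hasSum_theta2_mul_theta2 {τ σ : ℂ} (hτ : 0 < τ.im) (hσ : 0 < σ.im) :
    HasSum (fun p : ℤ × ℤ ↦ Complex.exp (Real.pi * Complex.I * ((p.1 : ℂ) + 1 / 2) ^ 2 * τ) *
      Complex.exp (Real.pi * Complex.I * ((p.2 : ℂ) + 1 / 2) ^ 2 * σ)) (theta2 τ * theta2 σ) :=
  hasSum_mul_tsum (summable_theta2_term hτ) (summable_theta2_term hσ)

lemma hasSum_theta3_mul_theta3 {τ σ : ℂ} (hτ : 0 < τ.im) (hσ : 0 < σ.im) :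
    HasSum (fun p : ℤ × ℤ ↦ Complex.exp (Real.pi * Complex.I * (p.1 : ℂ) ^ 2 * τ) *
      Complex.exp (Real.pi * Complex.I * (p.2 : ℂ) ^ 2 * σ)) (theta3 τ * theta3 σ) :=
  hasSum_mul_tsum (summable_theta3_term hτ) (summable_theta3_term hσ)

theorem A3_theta_factorization (τ : ℂ) (hτ : 0 < τ.im) :
    A3 τ = theta2 (2 * τ) * theta2 (6 * τ) + theta3 (2 * τ) * theta3 (6 * τ) := by
  have h2 : 0 < (2 * τ).im := by simpa using hτ
  have h6 : 0 < (6 * τ).im := by simpa using hτ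
  rw [add_comm]
  refine (hexLatticeParityEquiv.hasSum_iff.mp (HasSum.sum ?_ ?_)).tsum_eq
  · refine (hasSum_theta3_mul_theta3 h2 h6).congr_fun fun p ↦ ?_
    simp only [Function.comp_apply, hexLatticeParityEquiv, Equiv.coe_fn_mk, Sum.elim_inl,
      ← Complex.exp_add]
    push_cast
    ring_nf
  · refine (hasSum_theta2_mul_theta2 h2 h6).congr_fun fun p ↦ ?_
    simp only [Function.comp_apply, hexLatticeParityEquiv, Equiv.coe_fn_mk, Sum.elim_inr,
      ← Complex.exp_add]
    push_cast
    ring_nf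
end

section
/- For every τ in the complex upper half-plane, the Borwein function C₃ factors through theta constants with characteristics: C₃(τ) = θ_{(0,0)}(2τ)·θ_{(2/3,0)}(6τ) + θ_{(1/2,0)}(2τ)·θ_{(1/6,0)}(6τ). -/
noncomputable def thetaChar (a : ℝ) (τ : ℂ) : ℂ :=
  ∑' n : ℤ, Complex.exp (Real.pi * Complex.I * ((n : ℂ) + (a : ℂ))^2 * τ)
theorem summable_thetaChar_term (a : ℝ) {τ : ℂ} (hτ : 0 < τ.im) :
    Summable fun n : ℤ ↦ Complex.exp (Real.pi * Complex.I * ((n : ℂ) + (a : ℂ)) ^ 2 * τ) := by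
  refine (((summable_jacobiTheta₂_term_iff (a * τ) τ).mpr hτ).mul_left
    (Complex.exp (Real.pi * Complex.I * (a : ℂ) ^ 2 * τ))).congr fun n ↦ ?_
  rw [jacobiTheta₂_term, ← Complex.exp_add]
  ring_nf

theorem hasSum_thetaChar_mul_thetaChar (a b : ℝ) {σ τ : ℂ} (hσ : 0 < σ.im) (hτ : 0 < τ.im) :
    HasSum (fun p : ℤ × ℤ ↦
      Complex.exp (Real.pi * Complex.I * (((p.1 : ℂ) + a) ^ 2 * σ + ((p.2 : ℂ) + b) ^ 2 * τ)))
      (thetaChar a σ * thetaChar b τ) := by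
  have ha := summable_thetaChar_term a hσ
  have hb := summable_thetaChar_term b hτ
  have hab := summable_mul_of_summable_norm ha.norm hb.norm
  refine (HasSum.mul ha.hasSum hb.hasSum hab).congr_fun fun p ↦ ?_
  rw [← Complex.exp_add, mul_add, mul_assoc _ _ σ, mul_assoc _ _ τ]

/-- Splitting `ℤ × ℤ` by the parity of the second coordinate `n`, in the coordinates that complete
the square in `m ^ 2 + m * n + n ^ 2 + m + n`: odd `n` on the left, even `n` on the right. -/
def intProdParityEquiv : (ℤ × ℤ) ⊕ (ℤ × ℤ) ≃ ℤ × ℤ where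
  toFun := Sum.elim (fun p ↦ (p.1 - p.2 - 1, 2 * p.2 + 1)) (fun p ↦ (p.1 - p.2, 2 * p.2))
  invFun q := if q.2 % 2 = 0 then .inr (q.1 + q.2 / 2, q.2 / 2)
    else .inl (q.1 + q.2 / 2 + 1, q.2 / 2)
  left_inv := by
    rintro (⟨k, l⟩ | ⟨k, l⟩)
    · have h : (2 * l + 1) % 2 ≠ 0 := by lia
      have h' : (2 * l + 1) / 2 = l := by lia
      simp only [Sum.elim_inl, h, h', if_false, Sum.inl.injEq, Prod.mk.injEq, and_true]
      ring
    · simp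
  right_inv := by
    rintro ⟨m, n⟩
    dsimp only
    split_ifs with h <;> simp only [Sum.elim_inl, Sum.elim_inr, Prod.mk.injEq] <;> lia

theorem C3_theta_char_factorization (τ : ℂ) (hτ : 0 < τ.im) :
    C3 τ = thetaChar 0 (2 * τ) * thetaChar (2 / 3) (6 * τ) +
      thetaChar (1 / 2) (2 * τ) * thetaChar (1 / 6) (6 * τ) := by
  have h2 : 0 < (2 * τ).im := by simpa using hτ
  have h6 : 0 < (6 * τ).im := by simpa using hτ
  refine HasSum.tsum_eq (intProdParityEquiv.hasSum_iff.mp (HasSum.sum ?_ ?_))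
  · convert hasSum_thetaChar_mul_thetaChar 0 (2 / 3) h2 h6 using 2 with p
    simp only [Function.comp_apply, intProdParityEquiv, Equiv.coe_fn_mk, Sum.elim_inl]
    push_cast
    ring_nf
  · convert hasSum_thetaChar_mul_thetaChar (1 / 2) (1 / 6) h2 h6 using 2 with p
    simp only [Function.comp_apply, intProdParityEquiv, Equiv.coe_fn_mk, Sum.elim_inr]
    push_cast
    ring_nf
end

section
/- The Eisenstein series E₂, E₄, E₆ satisfy the Ramanujan identities: for every τ in the complex upper half-plane, (1/2πi)·dE₂/dτ = (1/12)(E₂(τ)² − E₄(τ)), (1/2πi)·dE₄/dτ = (1/3)(E₂(τ)E₄(τ) − E₆(τ)), and (1/2πi)·dE₆/dτ = (1/2)(E₂(τ)E₆(τ) − E₄(τ)²). -/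
noncomputable def E2 (τ : ℂ) : ℂ :=
  1 - 24 * ∑' n : ℕ, (∑ d ∈ Nat.divisors (n + 1), (d : ℂ)) *
    Complex.exp (2 * Real.pi * Complex.I * ((n : ℂ) + 1) * τ)

noncomputable def E4 (τ : ℂ) : ℂ :=
  1 + 240 * ∑' n : ℕ, (∑ d ∈ Nat.divisors (n + 1), (d : ℂ) ^ 3) *
    Complex.exp (2 * Real.pi * Complex.I * ((n : ℂ) + 1) * τ)

noncomputable def E6 (τ : ℂ) : ℂ :=
  1 - 504 * ∑' n : ℕ, (∑ d ∈ Nat.divisors (n + 1), (d : ℂ) ^ 5) *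
    Complex.exp (2 * Real.pi * Complex.I * ((n : ℂ) + 1) * τ)

section

open UpperHalfPlane hiding I
open Filter Topology Function MatrixGroups ModularForm Manifold Derivative

/-- A holomorphic function on `ℍ` that is modular of weight `k < 12` for `SL(2, ℤ)` and vanishes
at infinity is zero. -/
theorem eq_zero_of_slash_invariant_of_isZeroAtImInfty {k : ℤ} (hk : k < 12) {f : ℍ → ℂ}
    (hf : MDiff f) (hslash : ∀ γ : SL(2, ℤ), f ∣[k] γ = f) (hzero : IsZeroAtImInfty f) :
    f = 0 := by
  let g : CuspForm 𝒮ℒ k :=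
    { toFun := f
      slash_action_eq' := fun _ ⟨γ, hγ⟩ ↦ hγ ▸ hslash γ
      holo' := hf
      zero_at_cusps' := fun {c} hc ↦ by
        rw [Subgroup.IsArithmetic.isCusp_iff_isCusp_SL2Z] at hc
        rw [OnePoint.isZeroAt_iff_forall_SL2Z hc]
        intro γ _
        rw [hslash γ]
        exact hzero }
  have hg : g = 0 := rank_zero_iff_forall_zero.mp (CuspForm.rank_eq_zero_of_weight_lt_twelve hk) g
  exact congrArg DFunLike.coe hg

theorem periodic_of_hasSum_qParam {f : ℍ → ℂ} {c : ℕ → ℂ}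
    (hf : ∀ τ : ℍ, HasSum (fun m ↦ c m • Periodic.qParam 1 τ ^ m) (f τ)) :
    Periodic (f ∘ ofComplex) 1 := by
  intro w
  by_cases! hw : 0 < w.im
  · have hw' : 0 < (w + 1).im := by simpa using hw
    simp only [comp_apply, ofComplex_apply_of_im_pos hw, ofComplex_apply_of_im_pos hw']
    refine (hf ⟨w + 1, hw'⟩).unique ?_
    have hq : Periodic.qParam 1 (w + 1) = Periodic.qParam 1 w := by
      simp [Periodic.qParam, mul_add, Complex.exp_add]
    simpa [hq] using hf ⟨w, hw⟩
  · have hw' : (w + 1).im ≤ 0 := by simpa using hw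
    simp only [comp_apply, ofComplex_apply_of_im_nonpos hw, ofComplex_apply_of_im_nonpos hw']

/-- A function with a `q`-expansion tends to its constant coefficient at infinity. -/
theorem tendsto_atImInfty_of_hasSum_qParam {f : ℍ → ℂ} {c : ℕ → ℂ} (hfhol : MDiff f)
    (hf : ∀ τ : ℍ, HasSum (fun m ↦ c m • Periodic.qParam 1 τ ^ m) (f τ)) :
    Tendsto f atImInfty (𝓝 (c 0)) := by
  have hper : Periodic (f ∘ ofComplex) (1 : ℝ) := by simpa using periodic_of_hasSum_qParam hf
  have han := analyticAt_cuspFunction_zero one_pos hper hfhol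
    (isBoundedAtImInfty_of_hasSum_qExpansion one_pos hf)
  have h0 : cuspFunction 1 f 0 = c 0 := by
    simpa using ((hasFPowerSeriesOnBall_cuspFunction one_pos han hf).coeff_zero 0).symm
  rw [← h0]
  refine (han.continuousAt.tendsto.comp (qParam_tendsto_atImInfty one_pos)).congr fun τ ↦ ?_
  exact eq_cuspFunction τ one_ne_zero hper

/-- The derivative of a function with a `q`-expansion vanishes at infinity. -/
theorem isZeroAtImInfty_normalizedDerivOfComplex {f : ℍ → ℂ} {c : ℕ → ℂ} (hfhol : MDiff f)
    (hf : ∀ τ : ℍ, HasSum (fun m ↦ c m • Periodic.qParam 1 τ ^ m) (f τ)) :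
    IsZeroAtImInfty (normalizedDerivOfComplex f) := by
  have hper : Periodic (f ∘ ofComplex) (1 : ℝ) := by simpa using periodic_of_hasSum_qParam hf
  have hbdd := isBoundedAtImInfty_of_hasSum_qExpansion one_pos hf
  have han := analyticAt_cuspFunction_zero one_pos hper hfhol hbdd
  have key (τ : ℍ) : normalizedDerivOfComplex f τ =
      deriv (cuspFunction 1 f) (Periodic.qParam 1 τ) * Periodic.qParam 1 τ := by
    have hq : HasDerivAt (Periodic.qParam 1) (Periodic.qParam 1 τ * (2 * Real.pi * Complex.I))
        (τ : ℂ) := by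
      have := ((hasDerivAt_id (τ : ℂ)).const_mul (2 * Real.pi * Complex.I)).cexp
      have heq : Periodic.qParam 1 = fun w : ℂ ↦ Complex.exp (2 * Real.pi * Complex.I * w) := by
        ext w; simp [Periodic.qParam]
      simpa [heq] using this
    have hF := (differentiableAt_cuspFunction one_pos hper hfhol hbdd
      (Periodic.norm_qParam_lt_one one_pos τ.im_pos)).hasDerivAt
    have hcomp : (f ∘ ofComplex) =ᶠ[𝓝 (τ : ℂ)] cuspFunction 1 f ∘ Periodic.qParam 1 := by
      filter_upwards [isOpen_upperHalfPlaneSet.mem_nhds τ.im_pos] with w hw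
      have := eq_cuspFunction ⟨w, hw⟩ one_ne_zero hper
      simpa [ofComplex_apply_of_im_pos hw] using this.symm
    rw [normalizedDerivOfComplex, hcomp.deriv_eq, (hF.comp (τ : ℂ) hq).deriv]
    field_simp [Complex.two_pi_I_ne_zero]
  have hlim := (han.deriv.continuousAt.tendsto.comp (qParam_tendsto_atImInfty one_pos)).mul
    (qParam_tendsto_atImInfty one_pos)
  rw [mul_zero] at hlim
  exact hlim.congr fun τ ↦ (key τ).symm

theorem tendsto_E2_atImInfty : Tendsto EisensteinSeries.E2 atImInfty (𝓝 1) := by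
  simpa using tendsto_atImInfty_of_hasSum_qParam
    (c := fun m ↦ if m = 0 then 1 else -24 * ArithmeticFunction.sigma 1 m) E2_mdifferentiable
    fun τ ↦ by simpa [Periodic.qParam] using EisensteinSeries.hasSum_qExpansion_E2 (z := τ)

theorem isZeroAtImInfty_deriv_E2 :
    IsZeroAtImInfty (normalizedDerivOfComplex EisensteinSeries.E2) :=
  isZeroAtImInfty_normalizedDerivOfComplex
    (c := fun m ↦ if m = 0 then 1 else -24 * ArithmeticFunction.sigma 1 m) E2_mdifferentiable
    fun τ ↦ by simpa [Periodic.qParam] using EisensteinSeries.hasSum_qExpansion_E2 (z := τ)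

theorem hasSum_qParam_E {k : ℕ} (hk : 3 ≤ k) (τ : ℍ) :
    HasSum (fun m ↦ (qExpansion 1 (E hk)).coeff m • Periodic.qParam 1 τ ^ m) (E hk τ) :=
  hasSum_qExpansion (E hk) one_pos one_mem_strictPeriods_SL τ

theorem tendsto_E_atImInfty {k : ℕ} (hk : 3 ≤ k) (hk2 : Even k) :
    Tendsto (E hk) atImInfty (𝓝 1) := by
  rw [← EisensteinSeries.E_qExpansion_coeff_zero hk hk2]
  exact tendsto_atImInfty_of_hasSum_qParam (E hk).holo' (hasSum_qParam_E hk)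

theorem isZeroAtImInfty_deriv_E {k : ℕ} (hk : 3 ≤ k) :
    IsZeroAtImInfty (normalizedDerivOfComplex (E hk)) :=
  isZeroAtImInfty_normalizedDerivOfComplex (E hk).holo' (hasSum_qParam_E hk)

theorem E_slash {k : ℕ} (hk : 3 ≤ k) (γ : SL(2, ℤ)) : (E hk : ℍ → ℂ) ∣[(k : ℤ)] γ = E hk :=
  SlashInvariantFormClass.slash_action_eq (E hk) _ ⟨γ, rfl⟩


theorem hasDerivAt_D2 (γ : SL(2, ℤ)) (z : ℍ) :
    HasDerivAt (EisensteinSeries.D2 γ ∘ ofComplex)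
      (-(2 * Real.pi * Complex.I) * ((γ 1 0 : ℂ) / denom γ z) ^ 2) z := by
  have hz := denom_ne_zero γ z
  have hlin : HasDerivAt (fun w : ℂ ↦ (γ 1 0 : ℂ) * w + γ 1 1) (γ 1 0 : ℂ) z := by
    simpa using ((hasDerivAt_id (z : ℂ)).const_mul (γ 1 0 : ℂ)).add_const (γ 1 1 : ℂ)
  have hden : denom γ z = (γ 1 0 : ℂ) * z + γ 1 1 := ModularGroup.denom_apply γ z
  rw [hden] at hz ⊢
  have h := (hlin.inv hz).const_mul (2 * Real.pi * Complex.I * γ 1 0)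
  refine (h.congr_of_eventuallyEq ?_).congr_deriv ?_
  · filter_upwards [isOpen_upperHalfPlaneSet.mem_nhds z.im_pos] with w hw
    have hw' : denom γ w = (γ 1 0 : ℂ) * w + γ 1 1 := ModularGroup.denom_apply γ ⟨w, hw⟩
    simp [EisensteinSeries.D2, ofComplex_apply_of_im_pos hw, hw', div_eq_mul_inv]
  · field_simp

theorem mdifferentiable_D2 (γ : SL(2, ℤ)) : MDiff (EisensteinSeries.D2 γ) :=
  fun z ↦ mdifferentiableAt_iff.mpr (hasDerivAt_D2 γ z).differentiableAt

/-- The combination `D E₂ - E₂² / 12` is modular of weight `4`. -/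
theorem deriv_E2_sub_sq_slash (γ : SL(2, ℤ)) :
    (normalizedDerivOfComplex EisensteinSeries.E2 -
      (1 / 12 : ℂ) • (EisensteinSeries.E2 * EisensteinSeries.E2)) ∣[(4 : ℤ)] γ =
    normalizedDerivOfComplex EisensteinSeries.E2 -
      (1 / 12 : ℂ) • (EisensteinSeries.E2 * EisensteinSeries.E2) := by
  have hpi : (Real.pi : ℂ) ≠ 0 := by simp [Real.pi_ne_zero]
  have hslash := EisensteinSeries.E2_slash_action γ
  ext z
  have hE : (EisensteinSeries.E2 ∣[(2 : ℤ)] γ) z = EisensteinSeries.E2 z -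
      6 * Complex.I / Real.pi * (γ 1 0 / denom γ z) := by
    simp only [hslash, Pi.sub_apply, Pi.smul_apply, smul_eq_mul, EisensteinSeries.D2,
      riemannZeta_two]
    field_simp
  have hsq : ((EisensteinSeries.E2 * EisensteinSeries.E2) ∣[(4 : ℤ)] γ) z =
      (EisensteinSeries.E2 ∣[(2 : ℤ)] γ) z * (EisensteinSeries.E2 ∣[(2 : ℤ)] γ) z :=
    congrFun (ModularForm.mul_slash_SL2 2 2 γ EisensteinSeries.E2 EisensteinSeries.E2) z
  have hD : normalizedDerivOfComplex (EisensteinSeries.E2 ∣[(2 : ℤ)] γ) z =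
      (normalizedDerivOfComplex EisensteinSeries.E2 ∣[(4 : ℤ)] γ) z -
        2 * (2 * Real.pi * Complex.I)⁻¹ * (γ 1 0 / denom γ z) *
          (EisensteinSeries.E2 ∣[(2 : ℤ)] γ) z := by
    simpa using congrFun (normalizedDerivOfComplex_SL_slash (k := 2) E2_mdifferentiable (γ := γ)) z
  have hD' : normalizedDerivOfComplex (EisensteinSeries.E2 ∣[(2 : ℤ)] γ) z =
      normalizedDerivOfComplex EisensteinSeries.E2 z +
        3 / Real.pi ^ 2 * (γ 1 0 / denom γ z) ^ 2 := by
    rw [hslash, normalizedDerivOfComplex_sub _ _ E2_mdifferentiable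
      ((mdifferentiable_D2 γ).const_smul _), normalizedDerivOfComplex_smul _ _ (mdifferentiable_D2 γ)]
    simp only [Pi.sub_apply, Pi.smul_apply, smul_eq_mul, riemannZeta_two]
    rw [normalizedDerivOfComplex, normalizedDerivOfComplex, (hasDerivAt_D2 γ z).deriv]
    field_simp [Complex.I_ne_zero]
    ring
  rw [sub_eq_add_neg, SlashAction.add_slash, SlashAction.neg_slash, ModularForm.SL_smul_slash]
  simp only [Pi.add_apply, Pi.neg_apply, Pi.smul_apply, Pi.mul_apply, smul_eq_mul, hsq, hE]
  rw [hE] at hD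
  have := hD.symm.trans hD'
  rw [eq_add_of_sub_eq this]
  have hI : (Complex.I)⁻¹ = -Complex.I := Complex.inv_I
  simp only [mul_inv, hI]
  field_simp
  ring_nf
  simp only [Complex.I_sq]
  ring

theorem normalizedDerivOfComplex_E2 (z : ℍ) : normalizedDerivOfComplex EisensteinSeries.E2 z =
    (1 / 12) * (EisensteinSeries.E2 z ^ 2 - E₄ z) := by
  have h := eq_zero_of_slash_invariant_of_isZeroAtImInfty (k := 4) (by norm_num)
    (f := normalizedDerivOfComplex EisensteinSeries.E2 -
      (1 / 12 : ℂ) • (EisensteinSeries.E2 * EisensteinSeries.E2) + (1 / 12 : ℂ) • (E₄ : ℍ → ℂ))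
    (((normalizedDerivOfComplex_mdifferentiable E2_mdifferentiable).sub
      ((E2_mdifferentiable.mul E2_mdifferentiable).const_smul _)).add (E₄.holo'.const_smul _))
    (fun γ ↦ by
      rw [SlashAction.add_slash, deriv_E2_sub_sq_slash, ModularForm.SL_smul_slash]
      exact congrArg _ (congrArg _ (E_slash (k := 4) (by norm_num) γ)))
    (by
      have := (isZeroAtImInfty_deriv_E2.sub
        ((tendsto_E2_atImInfty.mul tendsto_E2_atImInfty).const_smul (1 / 12 : ℂ))).add
        ((tendsto_E_atImInfty (k := 4) (by norm_num) ⟨2, rfl⟩).const_smul (1 / 12 : ℂ))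
      simpa [IsZeroAtImInfty, ZeroAtFilter] using! this)
  have := congrFun h z
  simp only [Pi.add_apply, Pi.sub_apply, Pi.smul_apply, Pi.mul_apply, smul_eq_mul,
    Pi.zero_apply] at this
  linear_combination this

theorem normalizedDerivOfComplex_E4 (z : ℍ) : normalizedDerivOfComplex E₄ z =
    (1 / 3) * (EisensteinSeries.E2 z * E₄ z - E₆ z) := by
  have h := eq_zero_of_slash_invariant_of_isZeroAtImInfty (k := 6) (by norm_num)
    (f := serreDerivative 4 E₄ + (1 / 3 : ℂ) • (E₆ : ℍ → ℂ))
    ((serreDerivative_mdifferentiable 4 E₄.holo').add (E₆.holo'.const_smul _))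
    (fun γ ↦ by
      have hs : serreDerivative 4 E₄ ∣[(6 : ℤ)] γ = serreDerivative 4 E₄ :=
        serreDerivative_slash_invariant (k := 4) E₄.holo' (E_slash (k := 4) (by norm_num) γ)
      rw [SlashAction.add_slash, ModularForm.SL_smul_slash]
      exact congrArg₂ _ hs
        (congrArg _ (E_slash (k := 6) (by norm_num) γ)))
    (by
      have := ((isZeroAtImInfty_deriv_E (k := 4) (by norm_num)).sub
        ((tendsto_E2_atImInfty.const_mul (4 * 12⁻¹)).mul
          (tendsto_E_atImInfty (k := 4) (by norm_num) ⟨2, rfl⟩))).add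
        ((tendsto_E_atImInfty (k := 6) (by norm_num) ⟨3, rfl⟩).const_smul (1 / 3 : ℂ))
      rw [show (0 - 4 * 12⁻¹ * 1 * 1 + (1 / 3 : ℂ) • 1 : ℂ) = 0 by norm_num] at this
      exact this)
  have := congrFun h z
  simp only [Pi.add_apply, Pi.smul_apply, smul_eq_mul, serreDerivative_apply,
    Pi.zero_apply] at this
  linear_combination this

theorem normalizedDerivOfComplex_E6 (z : ℍ) : normalizedDerivOfComplex E₆ z =
    (1 / 2) * (EisensteinSeries.E2 z * E₆ z - E₄ z ^ 2) := by
  have h := eq_zero_of_slash_invariant_of_isZeroAtImInfty (k := 8) (by norm_num)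
    (f := serreDerivative 6 E₆ + (1 / 2 : ℂ) • ((E₄ : ℍ → ℂ) * E₄))
    ((serreDerivative_mdifferentiable 6 E₆.holo').add ((E₄.holo'.mul E₄.holo').const_smul _))
    (fun γ ↦ by
      have hs : serreDerivative 6 E₆ ∣[(8 : ℤ)] γ = serreDerivative 6 E₆ :=
        serreDerivative_slash_invariant (k := 6) E₆.holo' (E_slash (k := 6) (by norm_num) γ)
      have h4 := E_slash (k := 4) (by norm_num) γ
      rw [SlashAction.add_slash, ModularForm.SL_smul_slash]
      refine congrArg₂ _ hs (congrArg _ ?_)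
      exact (ModularForm.mul_slash_SL2 4 4 γ E₄ E₄).trans (congrArg₂ _ h4 h4))
    (by
      have h4 := tendsto_E_atImInfty (k := 4) (by norm_num) ⟨2, rfl⟩
      have := ((isZeroAtImInfty_deriv_E (k := 6) (by norm_num)).sub
        ((tendsto_E2_atImInfty.const_mul (6 * 12⁻¹)).mul
          (tendsto_E_atImInfty (k := 6) (by norm_num) ⟨3, rfl⟩))).add
        ((h4.mul h4).const_smul (1 / 2 : ℂ))
      rw [show (0 - 6 * 12⁻¹ * 1 * 1 + (1 / 2 : ℂ) • (1 * 1) : ℂ) = 0 by norm_num] at this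
      exact this)
  have := congrFun h z
  simp only [Pi.add_apply, Pi.smul_apply, Pi.mul_apply, smul_eq_mul, serreDerivative_apply,
    Pi.zero_apply] at this
  linear_combination this

theorem tsum_sigma_eq (k : ℕ) (z : ℍ) :
    ∑' n : ℕ, (∑ d ∈ Nat.divisors (n + 1), (d : ℂ) ^ k) *
      Complex.exp (2 * Real.pi * Complex.I * ((n : ℂ) + 1) * z) =
    ∑' n : ℕ+, ArithmeticFunction.sigma k n *
      Complex.exp (2 * Real.pi * Complex.I * z) ^ (n : ℕ) := by
  rw [tsum_pnat_eq_tsum_succ (f := fun n ↦ (ArithmeticFunction.sigma k n : ℂ) *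
    Complex.exp (2 * Real.pi * Complex.I * z) ^ n)]
  refine tsum_congr fun n ↦ ?_
  rw [← Complex.exp_nat_mul, ArithmeticFunction.sigma_apply]
  push_cast
  congr 2
  ring

theorem E2_coe (z : ℍ) : E2 z = EisensteinSeries.E2 z := by
  have := tsum_sigma_eq 1 z
  simp only [pow_one] at this
  rw [E2, this, EisensteinSeries.E2_eq_tsum_cexp]

theorem E4_coe (z : ℍ) : E4 z = E₄ z := by
  rw [E4, tsum_sigma_eq, EisensteinSeries.q_expansion_bernoulli _ ⟨2, rfl⟩,
    show bernoulli 4 = -1 / 30 by decide +kernel]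
  norm_num

theorem E6_coe (z : ℍ) : E6 z = E₆ z := by
  rw [E6, tsum_sigma_eq, EisensteinSeries.q_expansion_bernoulli _ ⟨3, rfl⟩,
    show bernoulli 6 = 1 / 42 by decide +kernel]
  norm_num

theorem normalizedDerivOfComplex_of_eqOn {f : ℂ → ℂ} {F : ℍ → ℂ} (h : ∀ z : ℍ, f z = F z)
    (z : ℍ) : (1 / (2 * Real.pi * Complex.I)) * deriv f z = normalizedDerivOfComplex F z := by
  have heq : f =ᶠ[𝓝 (z : ℂ)] F ∘ ofComplex := by
    filter_upwards [isOpen_upperHalfPlaneSet.mem_nhds z.im_pos] with w hw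
    simpa [ofComplex_apply_of_im_pos hw] using h ⟨w, hw⟩
  rw [normalizedDerivOfComplex, heq.deriv_eq, one_div]

end

theorem ramanujan_identities (τ : ℂ) (hτ : 0 < τ.im) :
    (1 / (2 * Real.pi * Complex.I)) * deriv E2 τ = (1 / 12) * (E2 τ ^ 2 - E4 τ) ∧
    (1 / (2 * Real.pi * Complex.I)) * deriv E4 τ = (1 / 3) * (E2 τ * E4 τ - E6 τ) ∧
    (1 / (2 * Real.pi * Complex.I)) * deriv E6 τ = (1 / 2) * (E2 τ * E6 τ - E4 τ ^ 2) := by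
  lift τ to UpperHalfPlane using hτ
  simp only [normalizedDerivOfComplex_of_eqOn E2_coe, normalizedDerivOfComplex_of_eqOn E4_coe,
    normalizedDerivOfComplex_of_eqOn E6_coe, E2_coe, E4_coe, E6_coe]
  exact ⟨normalizedDerivOfComplex_E2 τ, normalizedDerivOfComplex_E4 τ,
    normalizedDerivOfComplex_E6 τ⟩
end

section
/- For every τ in the complex upper half-plane, the logarithmic derivative of C_N^r·B_N^r equals the stated combination of E₂, for N = 2, 3, 4: (1/2πi)·(d/dτ)[θ₂(τ)⁸·θ₃(τ)⁴θ₄(τ)⁴] = ((2E₂(2τ)+E₂(τ))/3)·θ₂(τ)⁸θ₃(τ)⁴θ₄(τ)⁴; (1/2πi)·(d/dτ)[B₃(τ)³C₃(τ)³] = ((3E₂(3τ)+E₂(τ))/4)·B₃(τ)³C₃(τ)³; and (1/2πi)·(d/dτ)[θ₄(2τ)⁴θ₂(2τ)⁴] = ((E₂(τ)−2E₂(2τ)+4E₂(4τ))/3)·θ₄(2τ)⁴θ₂(2τ)⁴. -/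
/-- The Gaussian binomial coefficient with parameter `P`. -/
def gaussBinom (P : ℂ) : ℕ → ℕ → ℂ
  | _, 0 => 1
  | 0, _ + 1 => 0
  | m + 1, j + 1 => gaussBinom P m (j + 1) + P ^ (m - j) * gaussBinom P m j

/-- The finite `q`-Pochhammer product `(P; P)_m`. -/
def qFactorial (P : ℂ) (m : ℕ) : ℂ := ∏ k ∈ Finset.range m, (1 - P ^ (k + 1))

lemma gaussBinom_eq_zero (P : ℂ) {m j : ℕ} (h : m < j) : gaussBinom P m j = 0 := by
  induction m generalizing j with
  | zero => obtain ⟨j, rfl⟩ := Nat.exists_eq_succ_of_ne_zero h.ne'; simp [gaussBinom]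
  | succ m ih =>
    obtain ⟨j, rfl⟩ := Nat.exists_eq_succ_of_ne_zero (Nat.ne_zero_of_lt h)
    simp [gaussBinom, ih (show m < j by omega), ih (show m < j + 1 by omega)]

lemma gaussBinom_zero_right (P : ℂ) (m : ℕ) : gaussBinom P m 0 = 1 := by
  cases m <;> simp [gaussBinom]

lemma qFactorial_succ (P : ℂ) (m : ℕ) :
    qFactorial P (m + 1) = qFactorial P m * (1 - P ^ (m + 1)) := by
  simp [qFactorial, Finset.prod_range_succ]

lemma gaussBinom_self (P : ℂ) (m : ℕ) : gaussBinom P m m = 1 := by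
  induction m with
  | zero => simp [gaussBinom]
  | succ m ih => simp [gaussBinom, ih, gaussBinom_eq_zero]

lemma gaussBinom_add_mul_qFactorial (P : ℂ) (i j : ℕ) :
    gaussBinom P (i + j) j * (qFactorial P i * qFactorial P j) = qFactorial P (i + j) := by
  induction h : i + j generalizing i j with
  | zero =>
    obtain ⟨rfl, rfl⟩ : i = 0 ∧ j = 0 := by omega
    simp [gaussBinom, qFactorial]
  | succ n ih =>
    rcases i with _ | i
    · obtain rfl : j = n + 1 := by omega
      rw [gaussBinom_self]; simp [qFactorial]
    rcases j with _ | j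
    · obtain rfl : i = n := by omega
      rw [gaussBinom_zero_right]; simp [qFactorial]
    have h1 := ih i (j + 1) (by omega)
    have h2 := ih (i + 1) j (by omega)
    have hn : n - j = i + 1 := by omega
    rw [gaussBinom, hn, qFactorial_succ P n]
    have e : P ^ (n + 1) = P ^ (i + 1) * P ^ (j + 1) := by rw [← pow_add]; congr 1; omega
    rw [e]
    rw [qFactorial_succ] at h1 h2 ⊢
    rw [qFactorial_succ]
    linear_combination (1 - P ^ (i + 1)) * h1 + P ^ (i + 1) * (1 - P ^ (j + 1)) * h2

/-- Rothe's `q`-binomial theorem. -/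
lemma prod_one_add_mul_pow (P x : ℂ) (m : ℕ) :
    ∏ k ∈ Finset.range m, (1 + x * P ^ k) =
      ∑ j ∈ Finset.range (m + 1), gaussBinom P m j * P ^ (j.choose 2) * x ^ j := by
  induction m with
  | zero => simp [gaussBinom]
  | succ m ih =>
    have h1 : ∑ j ∈ Finset.range (m + 1), gaussBinom P m j * P ^ (j.choose 2) * x ^ j =
        ∑ j ∈ Finset.range (m + 1),
          gaussBinom P m (j + 1) * P ^ ((j + 1).choose 2) * x ^ (j + 1) + 1 := by
      have := Finset.sum_range_succ' (fun j => gaussBinom P m j * P ^ (j.choose 2) * x ^ j) (m + 1)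
      rw [Finset.sum_range_succ] at this
      simpa [gaussBinom_eq_zero, gaussBinom_zero_right] using this
    rw [Finset.prod_range_succ, ih, mul_add, mul_one]
    nth_rw 1 [h1]
    rw [Finset.sum_range_succ' _ (m + 1), Finset.sum_mul, add_right_comm, ← Finset.sum_add_distrib]
    congr 1
    · refine Finset.sum_congr rfl fun j hj => ?_
      have hj : j ≤ m := by simpa [Nat.lt_succ_iff] using hj
      have e : P ^ (m - j) * P ^ ((j + 1).choose 2) = P ^ (j.choose 2) * P ^ m := by
        rw [← pow_add, ← pow_add, Nat.choose_succ_succ' j 1, Nat.choose_one_right,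
          one_add_one_eq_two]
        congr 1; omega
      simp only [gaussBinom]
      linear_combination -gaussBinom P m j * x ^ (j + 1) * e
    · simp [gaussBinom_zero_right]

/-- MacMahon's finite form of the Jacobi triple product. -/
lemma prod_jacobi_finite {q w : ℂ} (hq : q ≠ 0) (hw : w ≠ 0) (N : ℕ) :
    ∏ k ∈ Finset.range N, (1 + w * q ^ (2 * k + 1)) * (1 + w⁻¹ * q ^ (2 * k + 1)) =
      ∑ j ∈ Finset.range (2 * N + 1),
        gaussBinom (q ^ 2) (2 * N) j * (q ^ (((j : ℤ) - N) ^ 2) * w ^ ((j : ℤ) - N)) := by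
  have key := prod_one_add_mul_pow (q ^ 2) (w * q / q ^ (2 * N)) (2 * N)
  have hN : ∏ k ∈ Finset.range N, (w * (q ^ (2 * k + 1))⁻¹) = w ^ N * (q ^ (N ^ 2))⁻¹ := by
    rw [Finset.prod_mul_distrib, Finset.prod_inv_distrib, Finset.prod_pow_eq_pow_sum]
    congr 3
    · simp
    · clear key
      induction N with
      | zero => simp
      | succ n ih => rw [Finset.sum_range_succ, ih]; ring
  have hlow : ∏ k ∈ Finset.range N, (1 + w * q / q ^ (2 * N) * (q ^ 2) ^ k) =
      w ^ N * (q ^ (N ^ 2))⁻¹ * ∏ k ∈ Finset.range N, (1 + w⁻¹ * q ^ (2 * k + 1)) := by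
    rw [← hN, ← Finset.prod_range_reflect, ← Finset.prod_mul_distrib]
    refine Finset.prod_congr rfl fun k hk => ?_
    have hk : k < N := Finset.mem_range.mp hk
    have e : q ^ (2 * N) = (q ^ 2) ^ (N - 1 - k) * q ^ (2 * k + 1) * q := by
      rw [← pow_mul, ← pow_add, ← pow_succ]; congr 1; omega
    rw [e]
    field_simp
    ring
  have hhigh : ∏ k ∈ Finset.range N, (1 + w * q / q ^ (2 * N) * (q ^ 2) ^ (N + k)) =
      ∏ k ∈ Finset.range N, (1 + w * q ^ (2 * k + 1)) := by
    refine Finset.prod_congr rfl fun k _ => ?_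
    field_simp
    ring
  rw [two_mul, Finset.prod_range_add, ← two_mul, hlow, hhigh] at key
  have hne : w ^ N * (q ^ (N ^ 2))⁻¹ ≠ 0 := by positivity
  rw [Finset.prod_mul_distrib]
  apply mul_left_cancel₀ hne
  rw [Finset.mul_sum]
  refine (Eq.trans (by ring) key).trans (Finset.sum_congr rfl fun j _ => ?_)
  have hc : ((j.choose 2 : ℕ) : ℤ) * 2 = (j : ℤ) * (j - 1) := by
    have := Nat.choose_two_right j
    have h2 : 2 ∣ j * (j - 1) := (Nat.even_mul_pred_self j).two_dvd
    have h3 : j.choose 2 * 2 = j * (j - 1) := by omega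
    rcases j with _ | j
    · simp
    · have := congrArg (Nat.cast : ℕ → ℤ) h3
      push_cast at this
      simpa using this
  have e : (q ^ 2) ^ (j.choose 2) * (w * q / q ^ (2 * N)) ^ j =
      w ^ N * (q ^ (N ^ 2))⁻¹ * (q ^ (((j : ℤ) - N) ^ 2) * w ^ ((j : ℤ) - N)) := by
    rw [div_pow, mul_pow, ← pow_mul, ← pow_mul]
    simp only [← zpow_natCast, ← zpow_neg, div_eq_mul_inv]
    have : (w ^ (N : ℤ) * q ^ (-((N ^ 2 : ℕ) : ℤ)) * (q ^ (((j : ℤ) - N) ^ 2) * w ^ ((j : ℤ) - N)))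
        = w ^ ((N : ℤ) + (j - N)) * q ^ (-((N ^ 2 : ℕ) : ℤ) + ((j : ℤ) - N) ^ 2) := by
      rw [zpow_add₀ hw, zpow_add₀ hq]; ring
    rw [this]
    have : q ^ ((2 * j.choose 2 : ℕ) : ℤ) *
          (w ^ (j : ℤ) * q ^ (j : ℤ) * q ^ (-((2 * N * j : ℕ) : ℤ))) =
        w ^ (j : ℤ) * q ^ (((2 * j.choose 2 : ℕ) : ℤ) + j + (-((2 * N * j : ℕ) : ℤ))) := by
      rw [zpow_add₀ hq, zpow_add₀ hq]; ring
    rw [this]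
    congr 2
    · ring
    · push_cast; linarith
  linear_combination gaussBinom (q ^ 2) (2 * N) j * e

lemma multipliable_one_add_mul_pow {q : ℂ} (hq : ‖q‖ < 1) (w : ℂ) :
    Multipliable fun k : ℕ => 1 + w * q ^ (2 * k + 1) := by
  apply multipliable_one_add_of_summable
  have h : Summable fun k : ℕ => ‖w * q‖ * (‖q‖ ^ 2) ^ k :=
    (summable_geometric_of_lt_one (by positivity)
      (pow_lt_one₀ (norm_nonneg q) hq two_ne_zero)).mul_left _
  refine h.congr fun k => ?_
  simp only [norm_mul, norm_pow]
  ring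

lemma tendsto_qFactorial {P : ℂ} (hP : ‖P‖ < 1) :
    Filter.Tendsto (qFactorial P) Filter.atTop (nhds (∏' k : ℕ, (1 - P ^ (k + 1)))) :=
  (ModularForm.multipliable_one_sub_pow hP).tendsto_prod_tprod_nat

lemma one_sub_pow_ne_zero {P : ℂ} (hP : ‖P‖ < 1) (k : ℕ) : 1 - P ^ (k + 1) ≠ 0 := by
  intro h
  have h1 : ‖P ^ (k + 1)‖ = 1 := by rw [← sub_eq_zero.mp h, norm_one]
  rw [norm_pow] at h1
  exact (pow_lt_one₀ (norm_nonneg P) hP k.succ_ne_zero).ne h1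

lemma tprod_one_sub_pow_ne_zero {P : ℂ} (hP : ‖P‖ < 1) : ∏' k : ℕ, (1 - P ^ (k + 1)) ≠ 0 := by
  have := tprod_one_add_ne_zero_of_summable (f := fun k : ℕ => -P ^ (k + 1))
    (fun k => by simpa [← sub_eq_add_neg] using one_sub_pow_ne_zero hP k) (by
      simpa using (summable_nat_add_iff 1).mpr (summable_geometric_of_lt_one (norm_nonneg _) hP))
  simpa [← sub_eq_add_neg] using this

lemma gaussBinom_add {P : ℂ} (hP : ‖P‖ < 1) (i j : ℕ) :
    gaussBinom P (i + j) j = qFactorial P (i + j) * (qFactorial P i)⁻¹ * (qFactorial P j)⁻¹ := by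
  have h (m : ℕ) : qFactorial P m ≠ 0 :=
    Finset.prod_ne_zero_iff.mpr fun k _ => one_sub_pow_ne_zero hP k
  have hi := h i
  have hj := h j
  rw [← gaussBinom_add_mul_qFactorial]
  field_simp

lemma exists_norm_gaussBinom_le {P : ℂ} (hP : ‖P‖ < 1) :
    ∃ C, ∀ m j : ℕ, ‖gaussBinom P m j‖ ≤ C := by
  obtain ⟨A, hA⟩ := (tendsto_qFactorial hP).norm.bddAbove_range
  obtain ⟨B, hB⟩ :=
    ((tendsto_qFactorial hP).inv₀ (tprod_one_sub_pow_ne_zero hP)).norm.bddAbove_range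
  replace hA (m : ℕ) : ‖qFactorial P m‖ ≤ A := hA ⟨m, rfl⟩
  replace hB (m : ℕ) : ‖(qFactorial P m)⁻¹‖ ≤ B := hB ⟨m, rfl⟩
  have hA0 : 0 ≤ A := (norm_nonneg _).trans (hA 0)
  have hB0 : 0 ≤ B := (norm_nonneg _).trans (hB 0)
  refine ⟨A * B * B, fun m j => ?_⟩
  rcases lt_or_ge m j with h | h
  · rw [gaussBinom_eq_zero P h, norm_zero]; positivity
  · obtain ⟨i, rfl⟩ := Nat.exists_eq_add_of_le' h
    rw [gaussBinom_add hP, norm_mul, norm_mul]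
    gcongr
    exacts [hA _, hB _, hB _]

/-- The Jacobi triple product identity. -/
theorem jacobi_triple_product {q w : ℂ} (hq0 : q ≠ 0) (hq : ‖q‖ < 1) (hw : w ≠ 0)
    (hs : Summable fun n : ℤ => q ^ (n ^ 2) * w ^ n) :
    ∑' n : ℤ, q ^ (n ^ 2) * w ^ n = (∏' k : ℕ, (1 - (q ^ 2) ^ (k + 1))) *
      ((∏' k : ℕ, (1 + w * q ^ (2 * k + 1))) * ∏' k : ℕ, (1 + w⁻¹ * q ^ (2 * k + 1))) := by
  have hP : ‖q ^ 2‖ < 1 := by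
    rw [norm_pow]; exact pow_lt_one₀ (norm_nonneg q) hq two_ne_zero
  set E := ∏' k : ℕ, (1 - (q ^ 2) ^ (k + 1)) with hE
  have hE0 : E ≠ 0 := tprod_one_sub_pow_ne_zero hP
  let f : ℕ → ℤ → ℂ := fun N n => if n ∈ Finset.Icc (-(N : ℤ)) N then
    gaussBinom (q ^ 2) (2 * N) (n + N).toNat * (q ^ (n ^ 2) * w ^ n) else 0
  have hf (N : ℕ) : ∑' n, f N n =
      ∏ k ∈ Finset.range N, (1 + w * q ^ (2 * k + 1)) * (1 + w⁻¹ * q ^ (2 * k + 1)) := by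
    rw [prod_jacobi_finite hq0 hw, tsum_eq_sum (s := Finset.Icc (-(N : ℤ)) N)
      (fun n hn => if_neg hn)]
    symm
    refine Finset.sum_nbij' (fun j => (j : ℤ) - N) (fun n => (n + N).toNat) ?_ ?_ ?_ ?_ ?_
    · intro j hj; simp only [Finset.mem_range, Finset.mem_Icc] at *; omega
    · intro j hj; simp only [Finset.mem_range, Finset.mem_Icc] at *; omega
    · intro j hj; simp
    · intro j hj; simp only [Finset.mem_Icc] at hj; omega
    · intro j hj
      have : (j : ℤ) - N ∈ Finset.Icc (-(N : ℤ)) N := by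
        simp only [Finset.mem_range, Finset.mem_Icc] at *; omega
      refine Eq.trans ?_ (if_pos this).symm
      simp
  have hprod : Filter.Tendsto (fun N => ∑' n, f N n) Filter.atTop
      (nhds ((∏' k : ℕ, (1 + w * q ^ (2 * k + 1))) * ∏' k : ℕ, (1 + w⁻¹ * q ^ (2 * k + 1)))) := by
    simp_rw [hf, Finset.prod_mul_distrib]
    exact (multipliable_one_add_mul_pow hq w).tendsto_prod_tprod_nat.mul
      (multipliable_one_add_mul_pow hq w⁻¹).tendsto_prod_tprod_nat
  obtain ⟨C, hC⟩ := exists_norm_gaussBinom_le hP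
  have hC0 : 0 ≤ C := (norm_nonneg _).trans (hC 0 0)
  have hsum : Filter.Tendsto (fun N => ∑' n, f N n) Filter.atTop
      (nhds (∑' n : ℤ, E⁻¹ * (q ^ (n ^ 2) * w ^ n))) := by
    refine tendsto_tsum_of_dominated_convergence (hs.norm.mul_left C) (fun n => ?_)
      (.of_forall fun N n => ?_)
    · have hadd (c : ℕ) (s : ℤ) (hc : 0 < c) :
          Filter.Tendsto (fun N : ℕ => (s + c * N).toNat) Filter.atTop Filter.atTop := by
        refine Filter.tendsto_atTop.mpr fun b => ?_
        filter_upwards [Filter.eventually_ge_atTop (b + s.natAbs)] with N hN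
        have : (N : ℤ) ≤ c * N := le_mul_of_one_le_left (by positivity) (by exact_mod_cast hc)
        omega
      have hq2 := tendsto_qFactorial hP
      have hlim := (((hq2.comp (hadd 2 0 two_pos)).mul
        ((hq2.comp (hadd 1 (-n) one_pos)).inv₀ hE0)).mul
        ((hq2.comp (hadd 1 n one_pos)).inv₀ hE0)).mul_const (q ^ (n ^ 2) * w ^ n)
      rw [← hE, mul_inv_cancel₀ hE0, one_mul] at hlim
      refine hlim.congr' ?_
      filter_upwards [Filter.eventually_ge_atTop n.natAbs] with N hN
      have hmem : n ∈ Finset.Icc (-(N : ℤ)) N := by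
        simp only [Finset.mem_Icc]; omega
      have h2 : 2 * N = (-n + (1 : ℕ) * N).toNat + (n + (1 : ℕ) * N).toNat := by omega
      have h3 : (0 + ((2 : ℕ) : ℤ) * N).toNat = 2 * N := by omega
      have h4 : (n + N).toNat = (n + (1 : ℕ) * N).toNat := by simp
      simp only [f, if_pos hmem, Function.comp_apply]
      rw [h3, h4]
      nth_rw 2 [h2]
      rw [gaussBinom_add hP, ← h2]
    · by_cases h : n ∈ Finset.Icc (-(N : ℤ)) N
      · simp only [f, if_pos h]
        rw [norm_mul]
        gcongr
        exact hC _ _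
      · simp only [f, if_neg h, norm_zero]
        positivity
  rw [tsum_mul_left] at hsum
  rw [← tendsto_nhds_unique hsum hprod, mul_inv_cancel_left₀ hE0]

section

open Complex Real

/-- The product `∏ (1 - e^{2πi(k+1)τ})`. -/
noncomputable def eulerProd (τ : ℂ) : ℂ :=
  ∏' k : ℕ, (1 - cexp (2 * π * I * τ) ^ (k + 1))

lemma norm_cexp_pi_mul_I_lt_one {τ : ℂ} (hτ : 0 < τ.im) : ‖cexp (π * I * τ)‖ < 1 := by
  rw [Complex.norm_exp, Real.exp_lt_one_iff]
  simpa using mul_pos pi_pos hτ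

/-- The Jacobi triple product for `jacobiTheta₂`. -/
lemma jacobiTheta₂_eq_tprod (z : ℂ) {τ : ℂ} (hτ : 0 < τ.im) :
    jacobiTheta₂ z τ = eulerProd τ *
      ((∏' k : ℕ, (1 + cexp (2 * π * I * z) * cexp (π * I * τ) ^ (2 * k + 1))) *
        ∏' k : ℕ, (1 + cexp (-(2 * π * I * z)) * cexp (π * I * τ) ^ (2 * k + 1))) := by
  have hterm (n : ℤ) : jacobiTheta₂_term n z τ =
      cexp (π * I * τ) ^ (n ^ 2) * cexp (2 * π * I * z) ^ n := by
    rw [jacobiTheta₂_term, ← Complex.exp_int_mul, ← Complex.exp_int_mul, ← Complex.exp_add]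
    congr 1; push_cast; ring
  have hs := (summable_jacobiTheta₂_term_iff z τ).mpr hτ
  simp_rw [hterm] at hs
  have key := jacobi_triple_product (Complex.exp_ne_zero _) (norm_cexp_pi_mul_I_lt_one hτ)
    (Complex.exp_ne_zero _) hs
  have h2 : cexp (π * I * τ) ^ 2 = cexp (2 * π * I * τ) := by
    rw [← Complex.exp_nat_mul]; congr 1; push_cast; ring
  rw [h2, ← Complex.exp_neg] at key
  simp_rw [jacobiTheta₂, hterm]
  exact key

lemma norm_cexp_two_pi_mul_I_lt_one {τ : ℂ} (hτ : 0 < τ.im) : ‖cexp (2 * π * I * τ)‖ < 1 :=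
  UpperHalfPlane.norm_exp_two_pi_I_lt_one ⟨τ, hτ⟩

lemma eulerProd_ne_zero {τ : ℂ} (hτ : 0 < τ.im) : eulerProd τ ≠ 0 :=
  tprod_one_sub_pow_ne_zero (norm_cexp_two_pi_mul_I_lt_one hτ)

lemma eta_eq_eulerProd (τ : ℂ) : ModularForm.eta τ = cexp (2 * π * I * τ / 24) * eulerProd τ := by
  simp [ModularForm.eta, ModularForm.eta_q_eq_pow, eulerProd, Function.Periodic.qParam]

lemma natCast_mul_im_pos (n : ℕ) [NeZero n] {τ : ℂ} (hτ : 0 < τ.im) : 0 < ((n : ℂ) * τ).im := by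
  have : (0 : ℝ) < n := by exact_mod_cast Nat.pos_of_neZero n
  simpa using mul_pos this hτ

lemma eulerProd_natCast_mul (n : ℕ) (τ : ℂ) :
    eulerProd (n * τ) = ∏' k : ℕ, (1 - cexp (2 * π * I * τ) ^ (n * (k + 1))) := by
  refine tprod_congr fun k => ?_
  rw [← Complex.exp_nat_mul, ← Complex.exp_nat_mul]
  congr 2; push_cast; ring

/-- Splitting the Euler product into odd and even exponents. -/
lemma eulerProd_eq_odd_mul {τ : ℂ} (hτ : 0 < τ.im) :
    eulerProd τ = (∏' k : ℕ, (1 - cexp (2 * π * I * τ) ^ (2 * k + 1))) * eulerProd (2 * τ) := by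
  have h := eulerProd_natCast_mul 2 τ
  rw [Nat.cast_two] at h
  rw [h, eulerProd, ← tprod_even_mul_odd]
  · exact congrArg₂ _ rfl (tprod_congr fun k => by ring)
  · have := multipliable_one_add_mul_pow (norm_cexp_two_pi_mul_I_lt_one hτ) (-1)
    simpa [← sub_eq_add_neg] using this
  · have := ModularForm.multipliable_one_sub_pow
      (norm_cexp_two_pi_mul_I_lt_one (natCast_mul_im_pos 2 hτ))
    refine this.congr fun k => ?_
    rw [← Complex.exp_nat_mul, ← Complex.exp_nat_mul]
    congr 2; push_cast; ring

lemma theta3_eq_jacobiTheta₂ (τ : ℂ) : theta3 τ = jacobiTheta₂ 0 τ :=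
  tsum_congr fun n => by simp [jacobiTheta₂_term]

lemma theta4_eq_jacobiTheta₂ (τ : ℂ) : theta4 τ = jacobiTheta₂ (1 / 2) τ := by
  refine tsum_congr fun n => ?_
  rw [jacobiTheta₂_term, Complex.exp_add, ← Complex.exp_pi_mul_I, ← Complex.exp_int_mul]
  congr 2; ring

lemma theta2_eq_jacobiTheta₂ (τ : ℂ) :
    theta2 τ = cexp (π * I * τ / 4) * jacobiTheta₂ (τ / 2) τ := by
  rw [theta2, jacobiTheta₂, ← tsum_mul_left]
  refine tsum_congr fun n => ?_
  rw [jacobiTheta₂_term, ← Complex.exp_add]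
  congr 1; ring

lemma multipliable_one_add_mul_cexp {τ : ℂ} (hτ : 0 < τ.im) (w : ℂ) :
    Multipliable fun k : ℕ => 1 + w * cexp (π * I * τ) ^ (2 * k + 1) :=
  multipliable_one_add_mul_pow (norm_cexp_pi_mul_I_lt_one hτ) w

lemma theta4_eq_tprod {τ : ℂ} (hτ : 0 < τ.im) :
    theta4 τ = eulerProd τ * (∏' k : ℕ, (1 - cexp (π * I * τ) ^ (2 * k + 1))) ^ 2 := by
  have h1 : cexp (2 * π * I * (1 / 2)) = -1 := by
    rw [← Complex.exp_pi_mul_I]; congr 1; ring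
  rw [theta4_eq_jacobiTheta₂, jacobiTheta₂_eq_tprod _ hτ, Complex.exp_neg, h1]
  norm_num [← sub_eq_add_neg, sq]

lemma theta3_mul_theta4 {τ : ℂ} (hτ : 0 < τ.im) :
    theta3 τ * theta4 τ * eulerProd (2 * τ) ^ 2 = eulerProd τ ^ 4 := by
  have h := eulerProd_eq_odd_mul hτ
  have hm : (∏' k : ℕ, (1 + 1 * cexp (π * I * τ) ^ (2 * k + 1))) *
      ∏' k : ℕ, (1 - cexp (π * I * τ) ^ (2 * k + 1)) =
      ∏' k : ℕ, (1 - cexp (2 * π * I * τ) ^ (2 * k + 1)) := by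
    rw [← (multipliable_one_add_mul_cexp hτ 1).tprod_mul
      (by simpa [← sub_eq_add_neg] using multipliable_one_add_mul_cexp hτ (-1))]
    refine tprod_congr fun k => ?_
    have : cexp (2 * π * I * τ) = cexp (π * I * τ) ^ 2 := by
      rw [← Complex.exp_nat_mul]; congr 1; push_cast; ring
    rw [this]; ring
  rw [theta4_eq_tprod hτ, theta3_eq_jacobiTheta₂, jacobiTheta₂_eq_tprod _ hτ]
  simp only [mul_zero, neg_zero, Complex.exp_zero]
  rw [← hm] at h
  have h4 := congrArg (· ^ 2 : ℂ → ℂ) h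
  linear_combination (-eulerProd τ ^ 2) * h4

lemma theta4_two_mul {τ : ℂ} (hτ : 0 < τ.im) :
    theta4 (2 * τ) * eulerProd (2 * τ) = eulerProd τ ^ 2 := by
  have h2 : 0 < (2 * τ).im := natCast_mul_im_pos 2 hτ
  rw [eulerProd_eq_odd_mul hτ, theta4_eq_tprod h2,
    show (π * I * (2 * τ) : ℂ) = 2 * π * I * τ by ring]
  ring

lemma theta2_mul_eulerProd {τ : ℂ} (hτ : 0 < τ.im) :
    theta2 τ * eulerProd τ = 2 * cexp (π * I * τ / 4) * eulerProd (2 * τ) ^ 2 := by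
  set Q := cexp (2 * π * I * τ) with hQ
  have hQ1 : ‖Q‖ < 1 := norm_cexp_two_pi_mul_I_lt_one hτ
  have hs : Summable fun k : ℕ => ‖Q ^ k‖ := by
    simpa using summable_geometric_of_lt_one (norm_nonneg _) hQ1
  have hm : Multipliable fun k : ℕ => 1 + Q ^ k := multipliable_one_add_of_summable hs
  have hm1 : Multipliable fun k : ℕ => 1 + Q ^ (k + 1) :=
    multipliable_one_add_of_summable ((summable_nat_add_iff 1).mpr hs)
  have hshift : ∏' k : ℕ, (1 + Q ^ k) = 2 * ∏' k : ℕ, (1 + Q ^ (k + 1)) := by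
    rw [tprod_eq_zero_mul' (f := fun k : ℕ => 1 + Q ^ k) hm1]; norm_num
  have hE : (∏' k : ℕ, (1 + Q ^ (k + 1))) * eulerProd τ = eulerProd (2 * τ) := by
    have := eulerProd_natCast_mul 2 τ
    rw [Nat.cast_two] at this
    rw [this, eulerProd, ← hm1.tprod_mul (ModularForm.multipliable_one_sub_pow hQ1)]
    exact tprod_congr fun k => by ring
  have h1 (k : ℕ) : cexp (2 * π * I * (τ / 2)) * cexp (π * I * τ) ^ (2 * k + 1) = Q ^ (k + 1) := by
    rw [hQ, ← Complex.exp_nat_mul, ← Complex.exp_nat_mul, ← Complex.exp_add]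
    congr 1; push_cast; ring
  have h2 (k : ℕ) : cexp (-(2 * π * I * (τ / 2))) * cexp (π * I * τ) ^ (2 * k + 1) = Q ^ k := by
    rw [hQ, ← Complex.exp_nat_mul, ← Complex.exp_nat_mul, ← Complex.exp_add]
    congr 1; push_cast; ring
  rw [theta2_eq_jacobiTheta₂, jacobiTheta₂_eq_tprod _ hτ]
  simp_rw [h1, h2]
  rw [hshift, ← hE]
  ring

lemma integral_cexp_two_pi_int (n : ℤ) :
    ∫ t in (0 : ℝ)..1, cexp (2 * π * I * n * t) = if n = 0 then 1 else 0 := by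
  split_ifs with h
  · simp [h]
  · have hc : 2 * π * I * n ≠ 0 := by simp [h, pi_ne_zero]
    rw [integral_exp_mul_complex hc]
    have : cexp (2 * π * I * n * (1 : ℝ)) = 1 := by
      rw [← Complex.exp_int_mul_two_pi_mul_I n]; congr 1; push_cast; ring
    rw [this]; simp

lemma jacobiTheta₂_term_add (n : ℤ) (t u τ : ℂ) :
    jacobiTheta₂_term n (t + u) τ = jacobiTheta₂_term n u τ * cexp (2 * π * I * n * t) := by
  rw [jacobiTheta₂_term, jacobiTheta₂_term, ← Complex.exp_add]; congr 1; ring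

lemma norm_cexp_two_pi_int_real (n : ℤ) (t : ℝ) : ‖cexp (2 * π * I * n * t)‖ = 1 := by
  rw [show (2 * π * I * n * t : ℂ) = ((2 * π * n * t : ℝ) : ℂ) * I by push_cast; ring,
    Complex.norm_exp_ofReal_mul_I]

/-- The constant Fourier coefficient of an absolutely convergent trigonometric series. -/
lemma hasSum_integral_trig {ι : Type*} [Countable ι] {a : ι → ℂ} (e : ι → ℤ) {F : ℝ → ℂ}
    (ha : Summable fun i => ‖a i‖)
    (hF : ∀ t : ℝ, HasSum (fun i => a i * cexp (2 * π * I * e i * t)) (F t)) :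
    HasSum (fun i => if e i = 0 then a i else 0) (∫ t in (0 : ℝ)..1, F t) := by
  have h := intervalIntegral.hasSum_integral_of_dominated_convergence
    (μ := MeasureTheory.volume) (a := 0) (b := 1)
    (F := fun i (t : ℝ) => a i * cexp (2 * π * I * e i * t)) (f := F) (fun i _ => ‖a i‖)
    (fun i => (by fun_prop : Continuous fun t : ℝ =>
      a i * cexp (2 * π * I * e i * t)).aestronglyMeasurable)
    (fun i => .of_forall fun t _ => by rw [norm_mul, norm_cexp_two_pi_int_real, mul_one])
    (.of_forall fun _ _ => ha) intervalIntegrable_const (.of_forall fun t _ => hF t)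
  refine h.congr_fun fun i => ?_
  rw [intervalIntegral.integral_const_mul, integral_cexp_two_pi_int]
  simp

lemma hasSum_mul_of_summable_norm {ι κ : Type*} {f : ι → ℂ} {g : κ → ℂ} {a b : ℂ}
    (hf : HasSum f a) (hg : HasSum g b) (hf' : Summable fun i => ‖f i‖)
    (hg' : Summable fun i => ‖g i‖) : HasSum (fun p : ι × κ => f p.1 * g p.2) (a * b) :=
  hf.mul hg (summable_mul_of_summable_norm hf' hg')

lemma summable_norm_mul {ι κ : Type*} {f : ι → ℂ} {g : κ → ℂ} (hf : Summable fun i => ‖f i‖)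
    (hg : Summable fun i => ‖g i‖) : Summable fun p : ι × κ => ‖f p.1 * g p.2‖ :=
  hf.mul_norm hg

lemma summable_norm_mul_mul {ι κ μ : Type*} {f : ι → ℂ} {g : κ → ℂ} {h : μ → ℂ}
    (hf : Summable fun i => ‖f i‖) (hg : Summable fun i => ‖g i‖)
    (hh : Summable fun i => ‖h i‖) :
    Summable fun p : ι × κ × μ => ‖f p.1 * (g p.2.1 * h p.2.2)‖ := by
  have key := summable_norm_mul (g := fun p : κ × μ => g p.1 * h p.2) hf (summable_norm_mul hg hh)
  exact key

lemma hasSum_mul_mul_of_summable_norm {ι κ μ : Type*} {f : ι → ℂ} {g : κ → ℂ} {h : μ → ℂ}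
    {a b c : ℂ} (hf : HasSum f a) (hg : HasSum g b) (hh : HasSum h c)
    (hf' : Summable fun i => ‖f i‖) (hg' : Summable fun i => ‖g i‖)
    (hh' : Summable fun i => ‖h i‖) :
    HasSum (fun p : ι × κ × μ => f p.1 * (g p.2.1 * h p.2.2)) (a * (b * c)) := by
  have key := hasSum_mul_of_summable_norm (f := f) (g := fun p : κ × μ => g p.1 * h p.2) hf
    (hasSum_mul_of_summable_norm hg hh hg' hh') hf' (summable_norm_mul hg' hh')
  exact key

lemma summable_norm_jacobiTheta₂_term (z : ℂ) {τ : ℂ} (hτ : 0 < τ.im) :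
    Summable fun n => ‖jacobiTheta₂_term n z τ‖ :=
  ((summable_jacobiTheta₂_term_iff z τ).mpr hτ).norm

lemma hasSum_jacobiTheta₂_mul (u v : ℂ) {τ : ℂ} (hτ : 0 < τ.im) (t : ℝ) :
    HasSum (fun p : ℤ × ℤ × ℤ => jacobiTheta₂_term p.1 0 τ *
        (jacobiTheta₂_term p.2.1 u τ * jacobiTheta₂_term p.2.2 v τ) *
        cexp (2 * π * I * (p.1 + p.2.1 + p.2.2 : ℤ) * t))
      (jacobiTheta₂ t τ * (jacobiTheta₂ (t + u) τ * jacobiTheta₂ (t + v) τ)) := by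
  have h2 := hasSum_mul_mul_of_summable_norm (hasSum_jacobiTheta₂_term t hτ)
    (hasSum_jacobiTheta₂_term (t + u) hτ) (hasSum_jacobiTheta₂_term (t + v) hτ)
    (summable_norm_jacobiTheta₂_term t hτ) (summable_norm_jacobiTheta₂_term (t + u) hτ)
    (summable_norm_jacobiTheta₂_term (t + v) hτ)
  convert h2 using 2 with p
  have ht := jacobiTheta₂_term_add p.1 t 0 τ
  rw [add_zero] at ht
  rw [jacobiTheta₂_term_add p.2.1 t u, jacobiTheta₂_term_add p.2.2 t v, ht]
  have : cexp (2 * π * I * (p.1 + p.2.1 + p.2.2 : ℤ) * t) = cexp (2 * π * I * p.1 * t) *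
      (cexp (2 * π * I * p.2.1 * t) * cexp (2 * π * I * p.2.2 * t)) := by
    rw [← Complex.exp_add, ← Complex.exp_add]; congr 1; push_cast; ring
  rw [this]; ring

/-- The constant Fourier coefficient of a product of three translated theta functions. -/
lemma hasSum_integral_jacobiTheta₂_mul (u v : ℂ) {τ : ℂ} (hτ : 0 < τ.im) :
    HasSum (fun p : ℤ × ℤ => cexp (2 * π * I * (p.1 * u + p.2 * v)) *
        cexp (2 * π * I * ((p.1 : ℂ) ^ 2 + p.1 * p.2 + (p.2 : ℂ) ^ 2) * τ))
      (∫ t in (0 : ℝ)..1,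
        jacobiTheta₂ t τ * (jacobiTheta₂ (t + u) τ * jacobiTheta₂ (t + v) τ)) := by
  have hs : Summable fun p : ℤ × ℤ × ℤ => ‖jacobiTheta₂_term p.1 0 τ *
      (jacobiTheta₂_term p.2.1 u τ * jacobiTheta₂_term p.2.2 v τ)‖ :=
    summable_norm_mul_mul (f := fun n => jacobiTheta₂_term n 0 τ)
      (g := fun n => jacobiTheta₂_term n u τ) (h := fun n => jacobiTheta₂_term n v τ)
      (summable_norm_jacobiTheta₂_term 0 hτ)
      (summable_norm_jacobiTheta₂_term u hτ) (summable_norm_jacobiTheta₂_term v hτ)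
  have h := hasSum_integral_trig (fun p : ℤ × ℤ × ℤ => p.1 + p.2.1 + p.2.2) hs
    (hasSum_jacobiTheta₂_mul u v hτ)
  have hinj : Function.Injective fun p : ℤ × ℤ => (-p.1 - p.2, p.1, p.2) := by
    intro p p' h
    simp only [Prod.mk.injEq] at h
    exact Prod.ext h.2.1 h.2.2
  rw [← hinj.hasSum_iff] at h
  · convert h using 2 with p
    rw [Function.comp_apply, if_pos (by ring)]
    simp only [jacobiTheta₂_term]
    rw [← Complex.exp_add, ← Complex.exp_add, ← Complex.exp_add]
    congr 1; push_cast; ring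
  · rintro ⟨i, b, c⟩ hp
    refine if_neg fun h0 => hp ⟨(b, c), ?_⟩
    simp only [Prod.mk.injEq, and_true]
    simp only at h0
    omega

lemma integral_jacobiTheta₂_natCast_mul (k : ℕ) [NeZero k] {τ : ℂ} (hτ : 0 < τ.im) :
    ∫ t in (0 : ℝ)..1, jacobiTheta₂ (k * t) τ = 1 := by
  have h := hasSum_integral_trig (a := fun n => jacobiTheta₂_term n 0 τ) (fun n => n * k)
    (F := fun t => jacobiTheta₂ (k * t) τ) ((summable_jacobiTheta₂_term_iff 0 τ).mpr hτ).norm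
    (fun t => by
      refine (hasSum_jacobiTheta₂_term (k * t) hτ).congr_fun fun n => ?_
      rw [← add_zero ((k : ℂ) * t), jacobiTheta₂_term_add]
      congr 2; push_cast; ring)
  refine h.unique ((hasSum_ite_eq (0 : ℤ) (1 : ℂ)).congr_fun fun n => ?_)
  by_cases hn : n = 0 <;> simp [hn, NeZero.ne k, jacobiTheta₂_term]

lemma tprod_one_add_mul_cube_root {q : ℂ} (hq : ‖q‖ < 1) {ω : ℂ} (hω : ω ^ 2 + ω + 1 = 0) (w : ℂ) :
    (∏' k : ℕ, (1 + w * q ^ (2 * k + 1))) * ((∏' k : ℕ, (1 + w * ω * q ^ (2 * k + 1))) *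
      ∏' k : ℕ, (1 + w * ω⁻¹ * q ^ (2 * k + 1))) =
      ∏' k : ℕ, (1 + w ^ 3 * (q ^ 3) ^ (2 * k + 1)) := by
  have hω0 : ω ≠ 0 := by rintro rfl; norm_num at hω
  have hinv : ω⁻¹ = ω ^ 2 := by
    rw [inv_eq_iff_eq_inv, eq_comm, inv_eq_iff_eq_inv, eq_comm, ← one_div, div_eq_iff hω0]
    linear_combination (1 - ω) * hω
  have hm (v : ℂ) : Multipliable fun k : ℕ => 1 + v * q ^ (2 * k + 1) :=
    multipliable_one_add_mul_pow hq v
  rw [← (hm _).tprod_mul (hm _), ← (hm _).tprod_mul ((hm _).mul (hm _))]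
  refine tprod_congr fun k => ?_
  rw [hinv, ← pow_mul, mul_comm 3, pow_mul]
  generalize q ^ (2 * k + 1) = x
  have h3 : ω ^ 3 = 1 := by linear_combination (ω - 1) * hω
  linear_combination (w * x + w ^ 2 * x ^ 2 * ω) * hω + w ^ 3 * x ^ 3 * h3

lemma tprod_one_add_mul_shift {q : ℂ} (hq0 : q ≠ 0) (hq : ‖q‖ < 1) (w : ℂ) :
    (∏' k : ℕ, (1 + w * (q ^ 3) ^ (2 * k + 1))) *
      ((∏' k : ℕ, (1 + w * q ^ 2 * (q ^ 3) ^ (2 * k + 1))) *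
        ∏' k : ℕ, (1 + w * (q ^ 2)⁻¹ * (q ^ 3) ^ (2 * k + 1))) =
      ∏' k : ℕ, (1 + w * q ^ (2 * k + 1)) := by
  have hq3 : ‖q ^ 3‖ < 1 := by
    rw [norm_pow]; exact pow_lt_one₀ (norm_nonneg _) hq (by norm_num)
  have hm (v : ℂ) : Multipliable fun k : ℕ => 1 + v * (q ^ 3) ^ (2 * k + 1) :=
    multipliable_one_add_mul_pow hq3 v
  have hm' : Multipliable fun k : ℕ => 1 + w * q ^ (2 * k + 1) := multipliable_one_add_mul_pow hq w
  have hl := (hm w).hasProd.tendsto_prod_nat.mul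
    ((hm (w * q ^ 2)).hasProd.tendsto_prod_nat.mul (hm (w * (q ^ 2)⁻¹)).hasProd.tendsto_prod_nat)
  have hr := hm'.hasProd.tendsto_prod_nat.comp
    (Filter.tendsto_id.const_mul_atTop' (by norm_num : 0 < 3))
  refine tendsto_nhds_unique hl (hr.congr fun n => ?_)
  simp only [Function.comp_apply, id]
  induction n with
  | zero => simp
  | succ n ih =>
    rw [mul_add_one, Finset.prod_range_succ, Finset.prod_range_succ, Finset.prod_range_succ, ih]
    simp only [Finset.prod_range_succ]
    have h1 : (q ^ 2)⁻¹ * (q ^ 3) ^ (2 * n + 1) = q ^ (2 * (3 * n) + 1) := by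
      rw [inv_mul_eq_iff_eq_mul₀ (pow_ne_zero _ hq0)]; ring
    rw [mul_assoc w (q ^ 2)⁻¹, h1]
    ring

/-- The product of the translates of the theta function by the cube roots of unity. -/
lemma jacobiTheta₂_mul_third (z : ℂ) {τ : ℂ} (hτ : 0 < τ.im) :
    jacobiTheta₂ z τ * (jacobiTheta₂ (z + 1 / 3) τ * jacobiTheta₂ (z + -(1 / 3)) τ) =
      eulerProd τ ^ 3 / eulerProd (3 * τ) * jacobiTheta₂ (3 * z) (3 * τ) := by
  have h3 : 0 < (3 * τ).im := natCast_mul_im_pos 3 hτ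
  have hE := eulerProd_ne_zero h3
  have hq := norm_cexp_pi_mul_I_lt_one hτ
  have hω : cexp (2 * π * I / 3) ^ 2 + cexp (2 * π * I / 3) + 1 = 0 := by
    have h := (Complex.isPrimitiveRoot_exp 3 (by norm_num)).geom_sum_eq_zero (by norm_num)
    simp only [Finset.sum_range_succ, Finset.sum_range_zero, Nat.cast_ofNat] at h
    linear_combination h
  set ω := cexp (2 * π * I / 3) with hωd
  have e1 : cexp (2 * π * I * (z + 1 / 3)) = cexp (2 * π * I * z) * ω := by
    rw [hωd, ← Complex.exp_add]; congr 1; ring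
  have e2 : cexp (2 * π * I * (z + -(1 / 3))) = cexp (2 * π * I * z) * ω⁻¹ := by
    rw [hωd, ← Complex.exp_neg, ← Complex.exp_add]; congr 1; ring
  have e3 : cexp (-(2 * π * I * (z + 1 / 3))) = cexp (-(2 * π * I * z)) * ω⁻¹ := by
    rw [hωd, ← Complex.exp_neg, ← Complex.exp_add]; congr 1; ring
  have e4 : cexp (-(2 * π * I * (z + -(1 / 3)))) = cexp (-(2 * π * I * z)) * ω := by
    rw [hωd, ← Complex.exp_add]; congr 1; ring
  have e5 : cexp (2 * π * I * (3 * z)) = cexp (2 * π * I * z) ^ 3 := by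
    rw [← Complex.exp_nat_mul]; congr 1; push_cast; ring
  have e6 : cexp (-(2 * π * I * (3 * z))) = cexp (-(2 * π * I * z)) ^ 3 := by
    rw [← Complex.exp_nat_mul]; congr 1; push_cast; ring
  have e7 : cexp (π * I * (3 * τ)) = cexp (π * I * τ) ^ 3 := by
    rw [← Complex.exp_nat_mul]; congr 1; push_cast; ring
  rw [jacobiTheta₂_eq_tprod _ hτ, jacobiTheta₂_eq_tprod _ hτ, jacobiTheta₂_eq_tprod _ hτ,
    jacobiTheta₂_eq_tprod _ h3, e1, e2, e3, e4, e5, e6, e7,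
    ← tprod_one_add_mul_cube_root hq hω, ← tprod_one_add_mul_cube_root hq hω]
  rw [← mul_assoc (_ / _), div_mul_cancel₀ _ hE]; ring

/-- The product of the translates of the theta function by a third of the period `3τ`. -/
lemma jacobiTheta₂_mul_period_third (z : ℂ) {τ : ℂ} (hτ : 0 < τ.im) :
    jacobiTheta₂ z (3 * τ) * (jacobiTheta₂ (z + τ) (3 * τ) * jacobiTheta₂ (z + -τ) (3 * τ)) =
      eulerProd (3 * τ) ^ 3 / eulerProd τ * jacobiTheta₂ z τ := by
  have h3 : 0 < (3 * τ).im := natCast_mul_im_pos 3 hτ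
  have hE := eulerProd_ne_zero hτ
  have hq := norm_cexp_pi_mul_I_lt_one hτ
  set q := cexp (π * I * τ) with hqd
  have e1 : cexp (2 * π * I * (z + τ)) = cexp (2 * π * I * z) * q ^ 2 := by
    rw [hqd, ← Complex.exp_nat_mul, ← Complex.exp_add]; congr 1; push_cast; ring
  have e2 : cexp (2 * π * I * (z + -τ)) = cexp (2 * π * I * z) * (q ^ 2)⁻¹ := by
    rw [hqd, ← Complex.exp_nat_mul, ← Complex.exp_neg, ← Complex.exp_add]
    congr 1; push_cast; ring
  have e3 : cexp (-(2 * π * I * (z + τ))) = cexp (-(2 * π * I * z)) * (q ^ 2)⁻¹ := by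
    rw [hqd, ← Complex.exp_nat_mul, ← Complex.exp_neg, ← Complex.exp_add]
    congr 1; push_cast; ring
  have e4 : cexp (-(2 * π * I * (z + -τ))) = cexp (-(2 * π * I * z)) * q ^ 2 := by
    rw [hqd, ← Complex.exp_nat_mul, ← Complex.exp_add]; congr 1; push_cast; ring
  have e7 : cexp (π * I * (3 * τ)) = q ^ 3 := by
    rw [← Complex.exp_nat_mul]; congr 1; push_cast; ring
  rw [jacobiTheta₂_eq_tprod _ hτ, jacobiTheta₂_eq_tprod _ h3, jacobiTheta₂_eq_tprod _ h3,
    jacobiTheta₂_eq_tprod _ h3, e1, e2, e3, e4, e7, ← hqd,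
    ← tprod_one_add_mul_shift (Complex.exp_ne_zero _) hq,
    ← tprod_one_add_mul_shift (Complex.exp_ne_zero _) hq]
  rw [← mul_assoc (_ / _), div_mul_cancel₀ _ hE]; ring

lemma B3_eq_eulerProd {τ : ℂ} (hτ : 0 < τ.im) : B3 τ = eulerProd τ ^ 3 / eulerProd (3 * τ) := by
  have h := hasSum_integral_jacobiTheta₂_mul (1 / 3) (-(1 / 3)) hτ
  have hi := integral_jacobiTheta₂_natCast_mul 3
    (natCast_mul_im_pos 3 hτ : 0 < (((3 : ℕ) : ℂ) * τ).im)
  rw [Nat.cast_ofNat] at hi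
  simp_rw [jacobiTheta₂_mul_third _ hτ] at h
  rw [intervalIntegral.integral_const_mul, hi, mul_one] at h
  rw [← h.tsum_eq, B3]
  refine tsum_congr fun p => ?_
  congr 2; ring

lemma hasSum_cexp_eulerProd {τ : ℂ} (hτ : 0 < τ.im) :
    HasSum (fun p : ℤ × ℤ => cexp (2 * π * I * (3 * ((p.1 : ℂ) ^ 2 + p.1 * p.2 + (p.2 : ℂ) ^ 2) +
      p.1 - p.2) * τ)) (eulerProd (3 * τ) ^ 3 / eulerProd τ) := by
  have h := hasSum_integral_jacobiTheta₂_mul τ (-τ) (natCast_mul_im_pos 3 hτ)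
  have hi := integral_jacobiTheta₂_natCast_mul 1 hτ
  simp only [Nat.cast_ofNat, Nat.cast_one, one_mul] at h hi
  simp_rw [jacobiTheta₂_mul_period_third _ hτ] at h
  rw [intervalIntegral.integral_const_mul, hi, mul_one] at h
  convert h using 2 with p
  rw [← Complex.exp_add]; congr 1; ring

lemma C3_eq_eulerProd {τ : ℂ} (hτ : 0 < τ.im) :
    C3 τ = 3 * cexp (2 * π * I * τ / 3) * (eulerProd (3 * τ) ^ 3 / eulerProd τ) := by
  have h := (hasSum_cexp_eulerProd hτ).mul_left (cexp (2 * π * I * τ / 3))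
  set S := cexp (2 * π * I * τ / 3) * (eulerProd (3 * τ) ^ 3 / eulerProd τ) with hS
  have key (r : ℤ) (φ : ℤ × ℤ → ℤ × ℤ) (hinj : φ.Injective)
      (hr : ∀ p, ((φ p).1 - (φ p).2) % 3 = r)
      (hsurj : ∀ p : ℤ × ℤ, (p.1 - p.2) % 3 = r → p ∈ Set.range φ)
      (hφ : ∀ p, (φ p).1 ^ 2 + (φ p).1 * (φ p).2 + (φ p).2 ^ 2 + (φ p).1 + (φ p).2 =
        3 * (p.1 ^ 2 + p.1 * p.2 + p.2 ^ 2) + p.1 - p.2) :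
      HasSum (fun p : ℤ × ℤ => if (p.1 - p.2) % 3 = r then cexp (2 * π * I *
        ((p.1 : ℂ) ^ 2 + p.1 * p.2 + (p.2 : ℂ) ^ 2 + p.1 + p.2 + 1 / 3) * τ) else 0) S := by
    rw [← hinj.hasSum_iff fun p hp => if_neg fun h0 => hp (hsurj p h0)]
    refine h.congr_fun fun p => ?_
    have hp : ((_ : ℤ) : ℂ) = _ := congrArg (Int.cast : ℤ → ℂ) (hφ p)
    push_cast at hp
    rw [Function.comp_apply, if_pos (hr p), hp, ← Complex.exp_add]
    congr 1; ring
  have h0 := key 0 (fun p => (2 * p.1 + p.2, -p.1 - 2 * p.2))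
    (fun p p' hp => by simp only [Prod.mk.injEq] at hp; ext <;> omega)
    (fun p => by dsimp only; omega)
    (fun p hp => ⟨(2 * ((p.1 - p.2) / 3) + p.2, -p.2 - (p.1 - p.2) / 3), by
      ext <;> dsimp only <;> omega⟩)
    (fun p => by ring)
  have h2 := key 2 (fun p => (-p.1 + p.2 - 1, 2 * p.1 + p.2))
    (fun p p' hp => by simp only [Prod.mk.injEq] at hp; ext <;> omega)
    (fun p => by dsimp only; omega)
    (fun p hp => ⟨(-((p.1 - p.2 + 1) / 3), p.1 + 1 - (p.1 - p.2 + 1) / 3), by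
      ext <;> dsimp only <;> omega⟩)
    (fun p => by ring)
  have h1 := key 1 (fun p => (-p.1 - 2 * p.2, -p.1 + p.2 - 1))
    (fun p p' hp => by simp only [Prod.mk.injEq] at hp; ext <;> omega)
    (fun p => by dsimp only; omega)
    (fun p hp => ⟨(-p.1 + 2 * ((p.1 - p.2 - 1) / 3), -((p.1 - p.2 - 1) / 3)), by
      ext <;> dsimp only <;> omega⟩)
    (fun p => by ring)
  have hsum := (h0.add h1).add h2
  rw [mul_assoc, ← hS, show 3 * S = S + S + S by ring, ← hsum.tsum_eq, C3]
  refine tsum_congr fun p => ?_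
  obtain hp | hp | hp : (p.1 - p.2) % 3 = 0 ∨ (p.1 - p.2) % 3 = 1 ∨ (p.1 - p.2) % 3 = 2 := by omega
  all_goals simp [hp]

lemma E2_eq_eisensteinSeries_E2 {τ : ℂ} (hτ : 0 < τ.im) :
    E2 τ = EisensteinSeries.E2 ⟨τ, hτ⟩ := by
  rw [EisensteinSeries.E2_eq_tsum_cexp, E2,
    tsum_pnat_eq_tsum_succ (f := fun n => (ArithmeticFunction.sigma 1 n : ℂ) * _ ^ n)]
  congr 2
  refine tsum_congr fun n => ?_
  rw [ArithmeticFunction.sigma_one_apply, Nat.cast_sum]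
  congr 1
  rw [← Complex.exp_nat_mul]
  congr 1
  push_cast
  ring_nf

lemma hasDerivAt_eta {τ : ℂ} (hτ : 0 < τ.im) :
    HasDerivAt ModularForm.eta (ModularForm.eta τ * (π * I / 12 * E2 τ)) τ := by
  have h := ModularForm.logDeriv_eta_eq_E2 ⟨τ, hτ⟩
  rw [← E2_eq_eisensteinSeries_E2, logDeriv_apply, div_eq_iff (ModularForm.eta_ne_zero hτ)] at h
  have hd := (ModularForm.differentiableAt_eta_of_mem_upperHalfPlaneSet hτ).hasDerivAt
  exact hd.congr_deriv (h.trans (mul_comm _ _))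

/-- The logarithmic derivative of an integer power of `η(mτ)`. -/
lemma hasDerivAt_eta_zpow (m : ℕ) [NeZero m] (k : ℤ) {τ : ℂ} (hτ : 0 < τ.im) :
    HasDerivAt (fun z => ModularForm.eta (m * z) ^ k)
      (ModularForm.eta (m * τ) ^ k * (2 * π * I * (k * m * E2 (m * τ) / 24))) τ := by
  have hm := natCast_mul_im_pos m hτ
  have h0 := ModularForm.eta_ne_zero hm
  have h := (hasDerivAt_zpow k _ (Or.inl h0)).comp τ
    ((hasDerivAt_eta hm).comp τ ((hasDerivAt_id τ).const_mul (m : ℂ)))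
  refine h.congr_deriv ?_
  rw [zpow_sub_one₀ h0]
  field_simp
  ring

/-- The derivative of a function which is an eta quotient on the upper half-plane. -/
lemma deriv_eta_quotient {f : ℂ → ℂ} (C : ℂ) (m n : ℕ) [NeZero m] [NeZero n] (a b c : ℤ)
    (hf : ∀ z : ℂ, 0 < z.im → f z = C * (ModularForm.eta z ^ a *
      (ModularForm.eta (m * z) ^ b * ModularForm.eta (n * z) ^ c)))
    {τ : ℂ} (hτ : 0 < τ.im) :
    1 / (2 * π * I) * deriv f τ =
      (a * E2 τ + b * m * E2 (m * τ) + c * n * E2 (n * τ)) / 24 * f τ := by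
  have he : f =ᶠ[nhds τ] fun z => C * (ModularForm.eta ((1 : ℕ) * z) ^ a *
      (ModularForm.eta (m * z) ^ b * ModularForm.eta (n * z) ^ c)) := by
    filter_upwards [(isOpen_lt continuous_const Complex.continuous_im).mem_nhds hτ] with z hz
    rw [hf z hz, Nat.cast_one, one_mul]
  have hd := ((hasDerivAt_eta_zpow 1 a hτ).mul
    ((hasDerivAt_eta_zpow m b hτ).mul (hasDerivAt_eta_zpow n c hτ))).const_mul C
  have hπ : 2 * π * I ≠ 0 := by simp [pi_ne_zero]
  rw [(hd.congr_of_eventuallyEq he).deriv, hf τ hτ, one_div, inv_mul_eq_iff_eq_mul₀ hπ]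
  simp only [Nat.cast_one, one_mul, Pi.mul_apply]
  ring

lemma theta_product_eq_eta {τ : ℂ} (hτ : 0 < τ.im) :
    theta2 τ ^ 8 * (theta3 τ ^ 4 * theta4 τ ^ 4) =
      256 * (ModularForm.eta τ ^ (8 : ℤ) * (ModularForm.eta ((2 : ℕ) * τ) ^ (8 : ℤ) *
        ModularForm.eta ((1 : ℕ) * τ) ^ (0 : ℤ))) := by
  have h2 : 0 < (2 * τ).im := natCast_mul_im_pos 2 hτ
  have hE1 := eulerProd_ne_zero hτ
  have hE2 := eulerProd_ne_zero h2
  have hθ2 := eq_div_of_mul_eq hE1 (theta2_mul_eulerProd hτ)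
  have hθ34 := eq_div_of_mul_eq (pow_ne_zero 2 hE2) (theta3_mul_theta4 hτ)
  have hexp : cexp (π * I * τ / 4) ^ 8 =
      cexp (2 * π * I * τ / 24) ^ 8 * cexp (2 * π * I * (2 * τ) / 24) ^ 8 := by
    simp_rw [← Complex.exp_nat_mul, ← Complex.exp_add]; congr 1; push_cast; ring
  rw [← mul_pow, hθ2, hθ34, eta_eq_eulerProd, eta_eq_eulerProd, zpow_zero, mul_one, Nat.cast_two,
    zpow_ofNat, zpow_ofNat, div_pow, div_pow, mul_pow, mul_pow, hexp]
  field_simp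
  ring

lemma borwein_product_eq_eta {τ : ℂ} (hτ : 0 < τ.im) :
    B3 τ ^ 3 * C3 τ ^ 3 =
      27 * (ModularForm.eta τ ^ (6 : ℤ) * (ModularForm.eta ((3 : ℕ) * τ) ^ (6 : ℤ) *
        ModularForm.eta ((1 : ℕ) * τ) ^ (0 : ℤ))) := by
  have h3 : 0 < (3 * τ).im := natCast_mul_im_pos 3 hτ
  have hE1 := eulerProd_ne_zero hτ
  have hE3 := eulerProd_ne_zero h3
  have hexp : cexp (2 * π * I * τ / 3) ^ 3 =
      cexp (2 * π * I * τ / 24) ^ 6 * cexp (2 * π * I * (3 * τ) / 24) ^ 6 := by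
    simp_rw [← Complex.exp_nat_mul, ← Complex.exp_add]; congr 1; push_cast; ring
  rw [B3_eq_eulerProd hτ, C3_eq_eulerProd hτ, eta_eq_eulerProd, eta_eq_eulerProd, zpow_zero,
    mul_one, Nat.cast_ofNat, zpow_ofNat, zpow_ofNat, mul_pow, mul_pow, hexp]
  field_simp
  ring

lemma theta_two_mul_product_eq_eta {τ : ℂ} (hτ : 0 < τ.im) :
    theta4 (2 * τ) ^ 4 * theta2 (2 * τ) ^ 4 =
      16 * (ModularForm.eta τ ^ (8 : ℤ) * (ModularForm.eta ((2 : ℕ) * τ) ^ (-8 : ℤ) *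
        ModularForm.eta ((4 : ℕ) * τ) ^ (8 : ℤ))) := by
  have h2 : 0 < (2 * τ).im := natCast_mul_im_pos 2 hτ
  have hE2 := eulerProd_ne_zero h2
  have hθ4 := eq_div_of_mul_eq hE2 (theta4_two_mul hτ)
  have hθ2 := eq_div_of_mul_eq hE2 (theta2_mul_eulerProd h2)
  have hexp : cexp (π * I * (2 * τ) / 4) ^ 4 * cexp (2 * π * I * (2 * τ) / 24) ^ 8 =
      cexp (2 * π * I * τ / 24) ^ 8 * cexp (2 * π * I * (4 * τ) / 24) ^ 8 := by
    simp_rw [← Complex.exp_nat_mul, ← Complex.exp_add]; congr 1; push_cast; ring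
  have h0 := Complex.exp_ne_zero (2 * π * I * (2 * τ) / 24)
  rw [← mul_assoc 2 2 τ, show (2 * 2 : ℂ) = 4 by norm_num] at hθ2
  rw [hθ4, hθ2, eta_eq_eulerProd, eta_eq_eulerProd, eta_eq_eulerProd, Nat.cast_two,
    Nat.cast_ofNat, zpow_neg, zpow_ofNat, zpow_ofNat, zpow_ofNat, ← div_eq_inv_mul]
  generalize cexp (2 * π * I * (2 * τ) / 24) = x at *
  generalize cexp (2 * π * I * (4 * τ) / 24) = y at *
  generalize cexp (2 * π * I * τ / 24) = z at *
  generalize cexp (π * I * (2 * τ) / 4) = w at *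
  generalize eulerProd (4 * τ) = e at *
  field_simp
  linear_combination 16 * eulerProd τ ^ 8 * e ^ 8 * hexp

end

theorem log_deriv_BC_products (τ : ℂ) (hτ : 0 < τ.im) :
    (1 / (2 * Real.pi * Complex.I)) *
        deriv (fun z => theta2 z ^ 8 * (theta3 z ^ 4 * theta4 z ^ 4)) τ =
      ((2 * E2 (2 * τ) + E2 τ) / 3) * (theta2 τ ^ 8 * (theta3 τ ^ 4 * theta4 τ ^ 4)) ∧
    (1 / (2 * Real.pi * Complex.I)) * deriv (fun z => B3 z ^ 3 * C3 z ^ 3) τ =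
      ((3 * E2 (3 * τ) + E2 τ) / 4) * (B3 τ ^ 3 * C3 τ ^ 3) ∧
    (1 / (2 * Real.pi * Complex.I)) *
        deriv (fun z => theta4 (2 * z) ^ 4 * theta2 (2 * z) ^ 4) τ =
      ((E2 τ - 2 * E2 (2 * τ) + 4 * E2 (4 * τ)) / 3) *
        (theta4 (2 * τ) ^ 4 * theta2 (2 * τ) ^ 4) := by
  refine ⟨?_, ?_, ?_⟩
  · rw [deriv_eta_quotient 256 2 1 8 8 0 (fun z hz => theta_product_eq_eta hz) hτ]
    push_cast; ring
  · rw [deriv_eta_quotient 27 3 1 6 6 0 (fun z hz => borwein_product_eq_eta hz) hτ]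
    push_cast; ring
  · rw [deriv_eta_quotient 16 2 4 8 (-8) 8 (fun z hz => theta_two_mul_product_eq_eta hz) hτ]
    push_cast; ring
end
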